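/- Let f : Y ⟶ X be a morphism of quasi-compact and quasi-separated schemes over Spec ℚ. Then there exist a small cofiltered category I, functors X• : I ⥤ Scheme and Y• : I ⥤ Scheme taking values in schemes of finite type over Spec ℚ and whose transition morphisms are affine, a natural transformation f• : Y• ⟶ X•, and cones π : X ⟶ X• and ρ : Y ⟶ Y• which are limit cones, such that for every i in I one has π_i ∘ f = f•_i ∘ ρ_i; that is, f is a cofiltered limit of morphisms of finite type ℚ-schemes along affine transition maps. -/

import Mathlib

open CategoryTheory CategoryTheory.Limits AlgebraicGeometry

/-- A ring homomorphism whose kernel and cokernel are `f`-power torsion becomes bijective after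
inverting `f`. -/
theorem bijective_awayMap_of_torsion {A C A' C' : Type*} [CommRing A] [CommRing C] [CommRing A']
    [CommRing C'] [Algebra A A'] [Algebra C C'] (α : A →+* C) (f : A) [IsLocalization.Away f A']
    [IsLocalization.Away (α f) C'] (β : A' →+* C')
    (comm : ∀ a, β (algebraMap A A' a) = algebraMap C C' (α a))
    (hker : ∀ a, α a = 0 → ∃ n : ℕ, f ^ n * a = 0)
    (hcoker : ∀ c, ∃ n : ℕ, ∃ a, α a = α f ^ n * c) : Function.Bijective β := by
  constructor
  · rw [injective_iff_map_eq_zero]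
    intro x hx
    obtain ⟨a, ⟨_, n, rfl⟩, rfl⟩ := IsLocalization.exists_mk'_eq (Submonoid.powers f) x
    have h1 : β (algebraMap A A' a) = 0 := by
      rw [← IsLocalization.mk'_spec A' a (⟨f ^ n, n, rfl⟩ : Submonoid.powers f), map_mul, hx,
        zero_mul]
    rw [comm, IsLocalization.map_eq_zero_iff (Submonoid.powers (α f))] at h1
    obtain ⟨⟨_, m, rfl⟩, hm⟩ := h1
    obtain ⟨k, hk⟩ := hker (f ^ m * a) (by simpa using hm)
    rw [IsLocalization.mk'_eq_zero_iff]
    exact ⟨⟨f ^ (k + m), k + m, rfl⟩, by rw [← hk]; ring⟩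
  · intro y
    obtain ⟨c, ⟨_, n, rfl⟩, rfl⟩ := IsLocalization.exists_mk'_eq (Submonoid.powers (α f)) y
    obtain ⟨m, a, ha⟩ := hcoker c
    refine ⟨IsLocalization.mk' A' a (⟨f ^ (m + n), m + n, rfl⟩ : Submonoid.powers f), ?_⟩
    rw [eq_comm, IsLocalization.mk'_eq_iff_eq_mul]
    have hu : IsUnit (algebraMap C C' (α f ^ m)) :=
      IsLocalization.map_units C' (⟨α f ^ m, m, rfl⟩ : Submonoid.powers (α f))
    refine hu.mul_left_cancel ?_
    rw [← map_mul, ← ha, ← comm,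
      ← IsLocalization.mk'_spec A' a (⟨f ^ (m + n), m + n, rfl⟩ : Submonoid.powers f), map_mul,
      comm]
    simp only [map_pow, pow_add, map_mul]
    ring

theorem exists_subalgebra_fg_of_torsion {B R C G : Type*} [CommRing B] [CommRing R] [CommRing C]
    [CommRing G] [Algebra B R] [Algebra B C] [Algebra B G] (φ : R →ₐ[B] G) (ψ : C →ₐ[B] G)
    (F : Finset B) (C' : B → Type*) [∀ f, CommRing (C' f)] [∀ f, Algebra C (C' f)]
    [∀ f, Algebra B (C' f)] [∀ f, IsScalarTower B C (C' f)]
    (hloc : ∀ f ∈ F, IsLocalization.Away (algebraMap B C f) (C' f))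
    (hfin : ∀ f ∈ F, Algebra.FiniteType B (C' f))
    (hker : ∀ f ∈ F, ∀ r, φ r = 0 → ∃ n : ℕ, f ^ n • r = 0)
    (hcoker : ∀ f ∈ F, ∀ s, ∃ n : ℕ, ∃ r, φ r = f ^ n • s) :
    ∃ A : Subalgebra B (R × C), A.FG ∧ (∀ x ∈ A, φ x.1 = ψ x.2) ∧
      (∀ f ∈ F, ∀ x ∈ A, x.2 = 0 → ∃ n : ℕ, f ^ n • x = 0) ∧
      (∀ f ∈ F, ∀ c, ∃ n : ℕ, ∃ x ∈ A, x.2 = f ^ n • c) := by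
  classical
  let E : Subalgebra B (R × C) :=
    AlgHom.equalizer (φ.comp (AlgHom.fst B R C)) (ψ.comp (AlgHom.snd B R C))
  have key : ∀ f ∈ F, ∃ S : Finset (R × C), (S : Set (R × C)) ⊆ E ∧
      ∀ c, ∃ n : ℕ, ∃ x ∈ Algebra.adjoin B (S : Set (R × C)), x.2 = f ^ n • c := by
    intro f hf
    have := hloc f hf
    obtain ⟨S, hS⟩ := (hfin f hf).out
    have lift : ∀ y : C' f, ∃ x ∈ E, ∃ n : ℕ,
        algebraMap C (C' f) x.2 = algebraMap B (C' f) f ^ n * y := by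
      intro y
      obtain ⟨c, ⟨_, n, rfl⟩, rfl⟩ :=
        IsLocalization.exists_mk'_eq (Submonoid.powers (algebraMap B C f)) y
      obtain ⟨m, r, hr⟩ := hcoker f hf (ψ c)
      refine ⟨(r, f ^ m • c), ?_, m + n, ?_⟩
      · simp [E, AlgHom.mem_equalizer, hr]
      · have := IsLocalization.mk'_spec (C' f) c
          (⟨(algebraMap B C f) ^ n, n, rfl⟩ : Submonoid.powers (algebraMap B C f))
        rw [Algebra.smul_def, map_mul, ← this, IsScalarTower.algebraMap_apply B C (C' f)]
        simp only [map_pow, pow_add]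
        ring
    choose e he N hN using lift
    refine ⟨S.image e, ?_, ?_⟩
    · intro x hx
      simp only [Finset.coe_image, Set.mem_image] at hx
      obtain ⟨y, -, rfl⟩ := hx
      exact he y
    · have aux : ∀ y ∈ Algebra.adjoin B (S : Set (C' f)), ∃ n : ℕ,
          ∃ x ∈ Algebra.adjoin B ((S.image e : Finset (R × C)) : Set (R × C)),
          algebraMap C (C' f) x.2 = algebraMap B (C' f) f ^ n * y := by
        intro y hy
        induction hy using Algebra.adjoin_induction with
        | mem y hy =>
          exact ⟨N y, e y, Algebra.subset_adjoin (by
            simpa using ⟨y, hy, rfl⟩), hN y⟩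
        | algebraMap r =>
          refine ⟨0, algebraMap B _ r, Subalgebra.algebraMap_mem _ _, ?_⟩
          simp [IsScalarTower.algebraMap_apply B C (C' f)]
        | add y z _ _ hy hz =>
          obtain ⟨n, x, hx, hx'⟩ := hy
          obtain ⟨m, w, hw, hw'⟩ := hz
          refine ⟨n + m, f ^ m • x + f ^ n • w,
            add_mem (Subalgebra.smul_mem _ hx _) (Subalgebra.smul_mem _ hw _), ?_⟩
          rw [Prod.snd_add, Prod.smul_snd, Prod.smul_snd]
          simp only [Algebra.smul_def, map_add, map_mul, hx', hw',
            ← IsScalarTower.algebraMap_apply B C (C' f), map_pow]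
          ring
        | mul y z _ _ hy hz =>
          obtain ⟨n, x, hx, hx'⟩ := hy
          obtain ⟨m, w, hw, hw'⟩ := hz
          refine ⟨n + m, x * w, mul_mem hx hw, ?_⟩
          simp only [Prod.snd_mul, map_mul, hx', hw']
          ring
      intro c
      obtain ⟨n, x, hx, hx'⟩ := aux (algebraMap C (C' f) c) (by rw [hS]; trivial)
      rw [IsScalarTower.algebraMap_apply B C (C' f), ← map_pow, ← map_mul,
        IsLocalization.eq_iff_exists (Submonoid.powers (algebraMap B C f))] at hx'
      obtain ⟨⟨_, m, rfl⟩, hm⟩ := hx'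
      refine ⟨m + n, f ^ m • x, Subalgebra.smul_mem _ hx _, ?_⟩
      rw [Prod.smul_snd]
      simp only [Algebra.smul_def, map_pow, pow_add]
      simpa [mul_assoc] using hm
  choose! S hSE hS using key
  refine ⟨Algebra.adjoin B ((F.biUnion S : Finset (R × C)) : Set (R × C)), ⟨_, rfl⟩, ?_, ?_, ?_⟩
  · have : Algebra.adjoin B ((F.biUnion S : Finset (R × C)) : Set (R × C)) ≤ E := by
      rw [Algebra.adjoin_le_iff]
      intro x hx
      simp only [Finset.coe_biUnion, Set.mem_iUnion] at hx
      obtain ⟨f, hf, hx⟩ := hx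
      exact hSE f hf hx
    intro x hx
    have := this hx
    simpa [E, AlgHom.mem_equalizer] using this
  · intro f hf x hx hx0
    have hxE : φ x.1 = ψ x.2 := by
      have : Algebra.adjoin B ((F.biUnion S : Finset (R × C)) : Set (R × C)) ≤ E := by
        rw [Algebra.adjoin_le_iff]
        intro x hx
        simp only [Finset.coe_biUnion, Set.mem_iUnion] at hx
        obtain ⟨f, hf, hx⟩ := hx
        exact hSE f hf hx
      have := this hx
      simpa [E, AlgHom.mem_equalizer] using this
    obtain ⟨n, hn⟩ := hker f hf x.1 (by rw [hxE, hx0, map_zero])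
    exact ⟨n, Prod.ext hn (by simp [hx0])⟩
  · intro f hf c
    obtain ⟨n, x, hx, hx'⟩ := hS f hf c
    refine ⟨n, x, Algebra.adjoin_mono ?_ hx, hx'⟩
    exact_mod_cast Finset.subset_biUnion_of_mem S hf

theorem torsion_of_bijective_awayMap {A C A' C' : Type*} [CommRing A] [CommRing C] [CommRing A']
    [CommRing C'] [Algebra A A'] [Algebra C C'] (α : A →+* C) (f : A) [IsLocalization.Away f A']
    [IsLocalization.Away (α f) C'] (β : A' →+* C')
    (comm : ∀ a, β (algebraMap A A' a) = algebraMap C C' (α a)) (hβ : Function.Bijective β) :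
    (∀ a, α a = 0 → ∃ n : ℕ, f ^ n * a = 0) ∧ ∀ c, ∃ n : ℕ, ∃ a, α a = α f ^ n * c := by
  constructor
  · intro a ha
    have h : algebraMap A A' a = 0 := hβ.1 (by rw [comm, ha, map_zero, map_zero])
    rw [IsLocalization.map_eq_zero_iff (Submonoid.powers f)] at h
    obtain ⟨⟨_, n, rfl⟩, hn⟩ := h
    exact ⟨n, hn⟩
  · intro c
    obtain ⟨y, hy⟩ := hβ.2 (algebraMap C C' c)
    obtain ⟨a, ⟨_, n, rfl⟩, rfl⟩ := IsLocalization.exists_mk'_eq (Submonoid.powers f) y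
    have h1 : algebraMap C C' (α a) = algebraMap C C' (α f ^ n * c) := by
      rw [← comm, ← IsLocalization.mk'_spec A' a (⟨f ^ n, n, rfl⟩ : Submonoid.powers f), map_mul,
        hy, comm, map_mul]
      simp only [map_pow]
      ring
    rw [IsLocalization.eq_iff_exists (Submonoid.powers (α f))] at h1
    obtain ⟨⟨_, m, rfl⟩, hm⟩ := h1
    refine ⟨m + n, f ^ m * a, ?_⟩
    rw [map_mul, map_pow, pow_add, mul_assoc]
    exact hm

theorem isIso_app_basicOpen_of_torsion {W Z : Scheme} [IsAffine Z] [CompactSpace W]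
    [QuasiSeparatedSpace W] (j : W ⟶ Z) (f : Γ(Z, ⊤))
    (hker : ∀ a, j.appTop a = 0 → ∃ n : ℕ, f ^ n * a = 0)
    (hcoker : ∀ c, ∃ n : ℕ, ∃ a, j.appTop a = j.appTop f ^ n * c) :
    IsIso (j.app (Z.basicOpen f)) := by
  have h1 : IsLocalization.Away f Γ(Z, Z.basicOpen f) :=
    isLocalization_basicOpen_of_qcqs isCompact_univ isQuasiSeparated_univ f
  have h2 : IsLocalization.Away (j.appTop f) Γ(W, W.basicOpen (j.appTop f)) :=
    isLocalization_basicOpen_of_qcqs isCompact_univ isQuasiSeparated_univ _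
  have e : j ⁻¹ᵁ Z.basicOpen f = W.basicOpen (j.appTop f) := Scheme.preimage_basicOpen_top ..
  have key : IsIso (j.appLE (Z.basicOpen f) (W.basicOpen (j.appTop f)) e.ge) := by
    rw [ConcreteCategory.isIso_iff_bijective]
    refine bijective_awayMap_of_torsion (A := Γ(Z, ⊤)) (C := Γ(W, ⊤)) (A' := Γ(Z, Z.basicOpen f))
      (C' := Γ(W, W.basicOpen (j.appTop f))) (j.appTop).hom f
      (j.appLE (Z.basicOpen f) (W.basicOpen (j.appTop f)) e.ge).hom ?_ hker hcoker
    intro a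
    change (Z.presheaf.map (homOfLE le_top).op ≫ j.appLE (Z.basicOpen f) _ e.ge) a =
      (j.appTop ≫ W.presheaf.map (homOfLE le_top).op) a
    rw [j.map_appLE, Scheme.Hom.appLE]
    rfl
  have : j.app (Z.basicOpen f) = j.appLE (Z.basicOpen f) (W.basicOpen (j.appTop f)) e.ge ≫
      W.presheaf.map (eqToHom e).op := by
    rw [j.appLE_map, Scheme.Hom.appLE_eq_app]
  rw [this]
  infer_instance

theorem isIso_of_isIso_appTop_of_isAffine {X Y : Scheme} [IsAffine X] [IsAffine Y] (f : X ⟶ Y)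
    [IsIso f.appTop] : IsIso f :=
  ((MorphismProperty.isomorphisms Scheme).arrow_mk_iso_iff (arrowIsoSpecΓOfIsAffine f)).mpr
    (inferInstanceAs (IsIso (Spec.map f.appTop)))

theorem isOpenImmersion_of_torsion {W Z : Scheme} [IsAffine Z] [CompactSpace W]
    [QuasiSeparatedSpace W] (j : W ⟶ Z) (F : Set Γ(Z, ⊤))
    (hcov : ∀ w : W, ∃ f ∈ F, w ∈ W.basicOpen (j.appTop f))
    (haff : ∀ f ∈ F, IsAffineOpen (W.basicOpen (j.appTop f)))
    (hker : ∀ f ∈ F, ∀ a, j.appTop a = 0 → ∃ n : ℕ, f ^ n * a = 0)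
    (hcoker : ∀ f ∈ F, ∀ c, ∃ n : ℕ, ∃ a, j.appTop a = j.appTop f ^ n * c) :
    IsOpenImmersion j ∧ Set.range j = ⋃ f ∈ F, (Z.basicOpen f : Set Z) := by
  have hiso : ∀ f ∈ F, IsIso (j ∣_ Z.basicOpen f) := by
    intro f hf
    have hZ : IsAffineOpen (Z.basicOpen f) := (isAffineOpen_top Z).basicOpen f
    have : IsAffine (Z.basicOpen f) := hZ
    have : IsAffine (j ⁻¹ᵁ Z.basicOpen f) := by
      have := haff f hf
      rw [← Scheme.preimage_basicOpen_top] at this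
      exact this
    have : IsIso (j ∣_ Z.basicOpen f).appTop := by
      have := isIso_app_basicOpen_of_torsion j f (hker f hf) (hcoker f hf)
      rw [morphismRestrict_appTop]
      have : IsIso (j.app ((Z.basicOpen f).ι ''ᵁ ⊤)) := by
        rw [Scheme.Opens.ι_image_top]; exact this
      exact IsIso.comp_isIso' this (Functor.map_isIso W.presheaf _)
    exact isIso_of_isIso_appTop_of_isAffine _
  have hrange : Set.range j = ⋃ f ∈ F, (Z.basicOpen f : Set Z) := by
    apply Set.Subset.antisymm
    · rintro _ ⟨w, rfl⟩
      obtain ⟨f, hf, hw⟩ := hcov w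
      rw [← Scheme.preimage_basicOpen_top] at hw
      simp only [Set.mem_iUnion]
      exact ⟨f, hf, hw⟩
    · intro z hz
      simp only [Set.mem_iUnion] at hz
      obtain ⟨f, hf, hz⟩ := hz
      have := hiso f hf
      obtain ⟨w, hw⟩ := (j ∣_ Z.basicOpen f).surjective ⟨z, hz⟩
      refine ⟨(j ⁻¹ᵁ Z.basicOpen f).ι w, ?_⟩
      rw [← Scheme.Hom.comp_apply, ← morphismRestrict_ι, Scheme.Hom.comp_apply, hw]
      rfl
  refine ⟨?_, hrange⟩
  refine IsZariskiLocalAtTarget.of_range_subset_iSup (P := @IsOpenImmersion)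
    (fun f : F ↦ Z.basicOpen f.1) ?_ ?_
  · rw [hrange]; simp
  · rintro ⟨f, hf⟩
    have := hiso f hf
    infer_instance

theorem torsion_of_isIso_app_basicOpen {W Z : Scheme} [CompactSpace Z] [QuasiSeparatedSpace Z]
    [CompactSpace W] [QuasiSeparatedSpace W] (j : W ⟶ Z) (f : Γ(Z, ⊤))
    [IsIso (j.app (Z.basicOpen f))] :
    (∀ a, j.appTop a = 0 → ∃ n : ℕ, f ^ n * a = 0) ∧
    ∀ c, ∃ n : ℕ, ∃ a, j.appTop a = j.appTop f ^ n * c := by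
  have h1 : IsLocalization.Away f Γ(Z, Z.basicOpen f) :=
    isLocalization_basicOpen_of_qcqs isCompact_univ isQuasiSeparated_univ f
  have h2 : IsLocalization.Away (j.appTop f) Γ(W, W.basicOpen (j.appTop f)) :=
    isLocalization_basicOpen_of_qcqs isCompact_univ isQuasiSeparated_univ _
  have e : j ⁻¹ᵁ Z.basicOpen f = W.basicOpen (j.appTop f) := Scheme.preimage_basicOpen_top ..
  refine torsion_of_bijective_awayMap (A := Γ(Z, ⊤)) (C := Γ(W, ⊤)) (A' := Γ(Z, Z.basicOpen f))
      (C' := Γ(W, W.basicOpen (j.appTop f))) (j.appTop).hom f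
      (j.appLE (Z.basicOpen f) (W.basicOpen (j.appTop f)) e.ge).hom ?_ ?_
  · intro a
    change (Z.presheaf.map (homOfLE le_top).op ≫ j.appLE (Z.basicOpen f) _ e.ge) a =
      (j.appTop ≫ W.presheaf.map (homOfLE le_top).op) a
    rw [j.map_appLE, Scheme.Hom.appLE]
    rfl
  · have : IsIso (j.appLE (Z.basicOpen f) (W.basicOpen (j.appTop f)) e.ge) := by
      have : j.appLE (Z.basicOpen f) (W.basicOpen (j.appTop f)) e.ge =
          j.app (Z.basicOpen f) ≫ W.presheaf.map (eqToHom e.symm).op := by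
        rw [Scheme.Hom.appLE]; rfl
      rw [this]
      infer_instance
    exact (ConcreteCategory.isIso_iff_bijective _).mp this

set_option maxHeartbeats 1000000 in
/-- A morphism `g : V ⟶ T` of affine schemes which factors over a compact open `D` through an
affine morphism of finite type `p : W ⟶ D` factors through an affine scheme of finite type
over `T` which restricts to `p` over `D`. -/
theorem exists_isPullback_of_factors_over_open {T V W : Scheme} [IsAffine T] [IsAffine V]
    (D : T.Opens) (hD : IsCompact (D : Set T)) (g : V ⟶ T) (p : W ⟶ D.toScheme) [IsAffineHom p]
    [LocallyOfFiniteType p] (q : (g ⁻¹ᵁ D).toScheme ⟶ W) (hq : q ≫ p = g ∣_ D) :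
    ∃ (Z : Scheme) (_ : IsAffine Z) (t : Z ⟶ T) (v : V ⟶ Z) (j : W ⟶ Z),
      LocallyOfFiniteType t ∧ IsPullback j p t D.ι ∧ v ≫ t = g ∧ q ≫ j = (g ⁻¹ᵁ D).ι ≫ v := by
  have : CompactSpace D := isCompact_iff_compactSpace.mp hD
  have : CompactSpace W := QuasiCompact.compactSpace_of_compactSpace p
  have : QuasiSeparatedSpace W := quasiSeparatedSpace_of_quasiSeparated (p ≫ D.ι)
  have : QuasiSeparatedSpace (g ⁻¹ᵁ D) := quasiSeparatedSpace_of_quasiSeparated (g ⁻¹ᵁ D).ι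
  have : CompactSpace (g ⁻¹ᵁ D) := QuasiCompact.compactSpace_of_compactSpace (g ∣_ D)
  have hq' : q ≫ p ≫ D.ι = (g ⁻¹ᵁ D).ι ≫ g := by
    rw [← Category.assoc, hq, morphismRestrict_ι]
  obtain ⟨F₀, hF₀, hDF⟩ := isCompact_and_isOpen_iff_finite_and_eq_biUnion_basicOpen.mp
    ⟨hD, D.isOpen⟩
  obtain ⟨F, rfl⟩ := hF₀.exists_finset_coe
  have hFD : ∀ f ∈ F, T.basicOpen f ≤ D := fun f hf x hx ↦ by
    change x ∈ (D : Set T)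
    rw [hDF]
    simp only [Set.mem_iUnion]
    exact ⟨f, hf, hx⟩
  let : Algebra Γ(T, ⊤) Γ(V, ⊤) := g.appTop.hom.toAlgebra
  let : Algebra Γ(T, ⊤) Γ(W, ⊤) := (p ≫ D.ι).appTop.hom.toAlgebra
  let : Algebra Γ(T, ⊤) Γ(g ⁻¹ᵁ D, ⊤) := ((g ⁻¹ᵁ D).ι ≫ g).appTop.hom.toAlgebra
  let φ : Γ(V, ⊤) →ₐ[Γ(T, ⊤)] Γ(g ⁻¹ᵁ D, ⊤) :=
    { (g ⁻¹ᵁ D).ι.appTop.hom with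
      commutes' := fun r ↦ by
        simp only [RingHom.algebraMap_toAlgebra, Scheme.Hom.comp_appTop]
        rfl }
  let ψ : Γ(W, ⊤) →ₐ[Γ(T, ⊤)] Γ(g ⁻¹ᵁ D, ⊤) :=
    { q.appTop.hom with
      commutes' := fun r ↦ by
        simp only [RingHom.algebraMap_toAlgebra, ← hq', Scheme.Hom.comp_appTop]
        rfl }
  let alg' (f : Γ(T, ⊤)) : Algebra Γ(T, ⊤) Γ(W, W.basicOpen ((p ≫ D.ι).appTop f)) :=
    ((algebraMap Γ(W, ⊤) _).comp (algebraMap Γ(T, ⊤) Γ(W, ⊤))).toAlgebra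
  have tower (f : Γ(T, ⊤)) : IsScalarTower Γ(T, ⊤) Γ(W, ⊤)
    Γ(W, W.basicOpen ((p ≫ D.ι).appTop f)) := .of_algebraMap_eq fun _ ↦ rfl
  have haff : ∀ f ∈ F, IsAffineOpen (W.basicOpen ((p ≫ D.ι).appTop f)) := by
    intro f hf
    rw [← Scheme.preimage_basicOpen_top, Scheme.Hom.comp_preimage]
    refine IsAffineOpen.preimage ?_ p
    refine ((isAffineOpen_top T).basicOpen f).preimage_of_isOpenImmersion D.ι ?_
    rw [Scheme.Opens.opensRange_ι]
    exact hFD f hf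
  have htors : ∀ f ∈ F, (∀ a, φ a = 0 → ∃ n : ℕ, f ^ n • a = 0) ∧
      ∀ s, ∃ n : ℕ, ∃ r, φ r = f ^ n • s := by
    intro f hf
    have : IsIso ((g ⁻¹ᵁ D).ι.app (V.basicOpen (g.appTop f))) := by
      refine (g ⁻¹ᵁ D).ι.isIso_app _ ?_
      rw [← Scheme.preimage_basicOpen_top, Scheme.Opens.opensRange_ι]
      exact fun x hx ↦ hFD f hf hx
    obtain ⟨h1, h2⟩ := torsion_of_isIso_app_basicOpen (g ⁻¹ᵁ D).ι (g.appTop f)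
    refine ⟨fun a ha ↦ ?_, fun s ↦ ?_⟩
    · obtain ⟨n, hn⟩ := h1 a ha
      refine ⟨n, ?_⟩
      rw [Algebra.smul_def, map_pow]
      exact hn
    · obtain ⟨n, r, hr⟩ := h2 s
      refine ⟨n, r, ?_⟩
      rw [Algebra.smul_def, map_pow]
      refine hr.trans ?_
      simp only [RingHom.algebraMap_toAlgebra, Scheme.Hom.comp_appTop]
      rfl
  obtain ⟨A, hAfg, hAeq, hAker, hAcoker⟩ := exists_subalgebra_fg_of_torsion φ ψ F
    (fun f ↦ Γ(W, W.basicOpen ((p ≫ D.ι).appTop f)))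
    (fun f hf ↦ isLocalization_basicOpen_of_qcqs isCompact_univ isQuasiSeparated_univ _)
    (fun f hf ↦ by
      have := (p ≫ D.ι).finiteType_appLE (isAffineOpen_top T) (haff f hf) le_top
      convert! this using 1)
    (fun f hf ↦ (htors f hf).1) (fun f hf ↦ (htors f hf).2)
  let αB : Γ(T, ⊤) ⟶ CommRingCat.of A := CommRingCat.ofHom (algebraMap Γ(T, ⊤) A)
  let αR : CommRingCat.of A ⟶ Γ(V, ⊤) :=
    CommRingCat.ofHom ((AlgHom.fst Γ(T, ⊤) Γ(V, ⊤) Γ(W, ⊤)).comp A.val).toRingHom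
  let αC : CommRingCat.of A ⟶ Γ(W, ⊤) :=
    CommRingCat.ofHom ((AlgHom.snd Γ(T, ⊤) Γ(V, ⊤) Γ(W, ⊤)).comp A.val).toRingHom
  have hBR : αB ≫ αR = g.appTop := by
    ext x
    exact ((AlgHom.fst Γ(T, ⊤) Γ(V, ⊤) Γ(W, ⊤)).comp A.val).commutes x
  have hBC : αB ≫ αC = (p ≫ D.ι).appTop := by
    ext x
    exact ((AlgHom.snd Γ(T, ⊤) Γ(V, ⊤) Γ(W, ⊤)).comp A.val).commutes x
  have hRC : αR ≫ (g ⁻¹ᵁ D).ι.appTop = αC ≫ q.appTop := by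
    ext x
    exact hAeq _ x.2
  let t : Spec (.of A) ⟶ T := Spec.map αB ≫ T.isoSpec.inv
  let v : V ⟶ Spec (.of A) := V.toSpecΓ ≫ Spec.map αR
  let j : W ⟶ Spec (.of A) := W.toSpecΓ ≫ Spec.map αC
  have ht : ∀ {S : Scheme} (h : S ⟶ T), S.toSpecΓ ≫ Spec.map h.appTop ≫ T.isoSpec.inv = h := by
    intro S h
    rw [← Scheme.toSpecΓ_naturality_assoc, ← Scheme.isoSpec_hom, Iso.hom_inv_id, Category.comp_id]
  have hvt : v ≫ t = g := by
    simp only [v, t, Category.assoc, ← Spec.map_comp_assoc, hBR, ht]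
  have hjt : j ≫ t = p ≫ D.ι := by
    simp only [j, t, Category.assoc, ← Spec.map_comp_assoc, hBC, ht]
  have hqj : q ≫ j = (g ⁻¹ᵁ D).ι ≫ v := by
    simp only [j, v, Scheme.toSpecΓ_naturality_assoc, ← Spec.map_comp, hRC]
  have hjΓ : j.appTop = (Scheme.ΓSpecIso _).hom ≫ αC := by
    simp only [j, Scheme.Hom.comp_appTop, Scheme.toSpecΓ_appTop, Scheme.ΓSpecIso_naturality]
  have hinv : T.isoSpec.inv.appTop = (Scheme.ΓSpecIso _).inv := by
    rw [← cancel_mono (Scheme.ΓSpecIso _).hom, Iso.inv_hom_id, ← Scheme.toSpecΓ_appTop,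
      ← Scheme.Hom.comp_appTop, ← Scheme.isoSpec_hom, Iso.hom_inv_id, Scheme.Hom.id_appTop]
  have htΓ : t.appTop ≫ (Scheme.ΓSpecIso (.of A)).hom = αB := by
    simp only [t, Scheme.Hom.comp_appTop, hinv, Category.assoc, Scheme.ΓSpecIso_naturality,
      Iso.inv_hom_id_assoc]
  have htΓ' (f) : (Scheme.ΓSpecIso (.of A)).hom (t.appTop f) = αB f := congr($htΓ f)
  have hjΓ' (a) : j.appTop a = αC ((Scheme.ΓSpecIso _).hom a) := congr($hjΓ a)
  have hinj : Function.Injective (Scheme.ΓSpecIso (.of A)).hom :=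
    ((ConcreteCategory.isIso_iff_bijective _).mp inferInstance).1
  have hsurj : Function.Surjective (Scheme.ΓSpecIso (.of A)).hom :=
    ((ConcreteCategory.isIso_iff_bijective _).mp inferInstance).2
  have hjtΓ (f) : j.appTop (t.appTop f) = (p ≫ D.ι).appTop f := by
    rw [← hjt, Scheme.Hom.comp_appTop]; rfl
  obtain ⟨hj, hrange⟩ := isOpenImmersion_of_torsion j (t.appTop '' F) (by
      intro w
      have hw : p w ∈ (⊤ : D.toScheme.Opens) := trivial
      have hw' : (D.ι (p w)) ∈ (D : Set T) := (p w).2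
      rw [hDF] at hw'
      simp only [Set.mem_iUnion] at hw'
      obtain ⟨f, hf, hfw⟩ := hw'
      refine ⟨_, ⟨f, hf, rfl⟩, ?_⟩
      rw [hjtΓ, ← Scheme.preimage_basicOpen_top, Scheme.Hom.comp_preimage]
      exact hfw) (by
      rintro _ ⟨f, hf, rfl⟩
      rw [hjtΓ]
      exact haff f hf) (by
      rintro _ ⟨f, hf, rfl⟩ a ha
      obtain ⟨n, hn⟩ := hAker f hf _ ((Scheme.ΓSpecIso (.of A)).hom a).2 (by rw [← ha, hjΓ']; rfl)
      refine ⟨n, hinj ?_⟩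
      rw [map_mul, map_pow, map_zero, htΓ']
      refine Subtype.ext ?_
      rw [Algebra.smul_def] at hn
      refine Eq.trans ?_ hn
      rw [map_pow]
      rfl) (by
      rintro _ ⟨f, hf, rfl⟩ c
      obtain ⟨n, x, hx, hxc⟩ := hAcoker f hf c
      obtain ⟨a, ha⟩ := hsurj ⟨x, hx⟩
      refine ⟨n, a, ?_⟩
      rw [hjΓ', ha, hjtΓ]
      refine Eq.trans hxc ?_
      rw [Algebra.smul_def, map_pow]
      rfl)
  have hft : LocallyOfFiniteType t := by
    have : LocallyOfFiniteType (Spec.map αB) := by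
      rw [HasRingHomProperty.Spec_iff (P := @LocallyOfFiniteType)]
      have : Algebra.FiniteType Γ(T, ⊤) A := A.fg_iff_finiteType.mp hAfg
      exact RingHom.finiteType_algebraMap.mpr this
    infer_instance
  refine ⟨_, inferInstance, t, v, j, hft, ?_, hvt, hqj⟩
  refine (IsOpenImmersion.isPullback p j D.ι t hjt ?_).flip
  rw [Scheme.Opens.opensRange_ι]
  ext x
  change t x ∈ (D : Set T) ↔ x ∈ Set.range j
  rw [hrange, hDF]
  simp only [Set.mem_iUnion, exists_prop, SetLike.mem_coe, Set.mem_image,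
    exists_exists_and_eq_and, ← Scheme.preimage_basicOpen_top]
  rfl

theorem exists_isPushout_of_isOpenImmersion {W U V : Scheme} (i : W ⟶ U) (j : W ⟶ V)
    [IsOpenImmersion i] [IsOpenImmersion j] :
    ∃ (P : Scheme) (a : U ⟶ P) (b : V ⟶ P), IsOpenImmersion a ∧ IsOpenImmersion b ∧
      IsPushout i j a b ∧ (∀ x, x ∈ Set.range a ∨ x ∈ Set.range b) ∧
      ∀ x y, a x = b y → ∃ w, i w = x ∧ j w = y := by
  have (k l : WalkingSpan) (f : k ⟶ l) : IsOpenImmersion ((span i j).map f) := by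
    rcases f with _ | (_ | _)
    · simp only [WidePushoutShape.hom_id]; infer_instance
    · exact inferInstanceAs (IsOpenImmersion i)
    · exact inferInstanceAs (IsOpenImmersion j)
  have : HasPushout i j := inferInstanceAs (HasColimit (span i j))
  refine ⟨pushout i j, pushout.inl i j, pushout.inr i j,
    inferInstanceAs (IsOpenImmersion (colimit.ι (span i j) WalkingSpan.left)),
    inferInstanceAs (IsOpenImmersion (colimit.ι (span i j) WalkingSpan.right)),
    IsPushout.of_hasPushout i j, fun x ↦ ?_, fun x y hxy ↦ ?_⟩
  · obtain ⟨k, y, rfl⟩ := Scheme.IsLocallyDirected.ι_jointly_surjective (span i j) x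
    rcases k with _ | (_ | _)
    · exact .inl ⟨i y, congr($(colimit.w (span i j) WalkingSpan.Hom.fst) y)⟩
    · exact .inl ⟨y, rfl⟩
    · exact .inr ⟨y, rfl⟩
  · obtain ⟨k, f, g, z, hf, hg⟩ := (Scheme.IsLocallyDirected.ι_eq_ι_iff (span i j)
      (i := WalkingSpan.left) (j := WalkingSpan.right)).mp hxy
    rcases f with _ | _
    · rcases g
    · rcases g with _ | _
      exact ⟨z, hf, hg⟩

theorem of_isPullback_of_jointly_surjective (Q : MorphismProperty Scheme)
    [IsZariskiLocalAtTarget Q] {P S U₀ V₀ U V : Scheme} (h : P ⟶ S) (aU : U₀ ⟶ P) (aV : V₀ ⟶ P)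
    (bU : U ⟶ S) (bV : V ⟶ S) [IsOpenImmersion bU] [IsOpenImmersion bV] (hU : U₀ ⟶ U)
    (hV : V₀ ⟶ V) (sqU : IsPullback aU hU h bU) (sqV : IsPullback aV hV h bV)
    (hcov : ∀ x, x ∈ Set.range bU ∨ x ∈ Set.range bV) (qU : Q hU) (qV : Q hV) : Q h := by
  have aux : ∀ {U₀ U : Scheme} (a : U₀ ⟶ P) (b : U ⟶ S) [IsOpenImmersion b] (k : U₀ ⟶ U),
      IsPullback a k h b → Q k → Q (h ∣_ b.opensRange) := by
    intro U₀ U a b _ k sq qk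
    rw [Q.arrow_mk_iso_iff (morphismRestrictOpensRange h b)]
    rwa [← sq.isoPullback_hom_snd, Q.cancel_left_of_respectsIso] at qk
  refine IsZariskiLocalAtTarget.of_forall_exists_morphismRestrict (P := Q) fun x ↦ ?_
  rcases hcov x with hx | hx
  · exact ⟨bU.opensRange, hx, aux aU bU hU sqU qU⟩
  · exact ⟨bV.opensRange, hx, aux aV bV hV sqV qV⟩

theorem isPullback_of_preimage_range_subset {U₀ P U S : Scheme} (a : U₀ ⟶ P) (h : P ⟶ S)
    (hU : U₀ ⟶ U) (b : U ⟶ S) [IsOpenImmersion a] [IsOpenImmersion b] (w : a ≫ h = hU ≫ b)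
    (H : ∀ x, h x ∈ Set.range b → x ∈ Set.range a) : IsPullback a hU h b := by
  refine (IsOpenImmersion.isPullback hU a b h w (le_antisymm (fun x hx ↦ H x hx) ?_)).flip
  rintro _ ⟨x, rfl⟩
  exact ⟨hU x, by rw [← Scheme.Hom.comp_apply, ← Scheme.Hom.comp_apply, w]⟩

theorem exists_eq_eq_of_isPullback {K U V X : Scheme} {kU : K ⟶ U} {kV : K ⟶ V} {cU : U ⟶ X}
    {cV : V ⟶ X} (sq : IsPullback kU kV cU cV) (y : U) (z : V) (h : cU y = cV z) :
    ∃ k, kU k = y ∧ kV k = z := by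
  obtain ⟨w, rfl, rfl⟩ := Scheme.Pullback.exists_preimage_pullback y z h
  exact ⟨sq.isoPullback.inv w, by rw [← Scheme.Hom.comp_apply, sq.isoPullback_inv_fst],
    by rw [← Scheme.Hom.comp_apply, sq.isoPullback_inv_snd]⟩

theorem isPushout_of_isPullback_of_isOpenImmersion {K U V X : Scheme} {kU : K ⟶ U} {kV : K ⟶ V}
    {cU : U ⟶ X} {cV : V ⟶ X} [IsOpenImmersion cU] [IsOpenImmersion cV]
    (sq : IsPullback kU kV cU cV) (hcov : ∀ x, x ∈ Set.range cU ∨ x ∈ Set.range cV) :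
    IsPushout kU kV cU cV := by
  have : IsOpenImmersion kU := MorphismProperty.of_isPullback sq.flip inferInstance
  have : IsOpenImmersion kV := MorphismProperty.of_isPullback sq inferInstance
  obtain ⟨P, a, b, _, _, po, cov, -⟩ := exists_isPushout_of_isOpenImmersion kU kV
  let h : P ⟶ X := po.desc cU cV sq.w
  have ha : a ≫ h = cU := po.inl_desc _ _ _
  have hb : b ≫ h = cV := po.inr_desc _ _ _
  have ha' (x) : h (a x) = cU x := by rw [← Scheme.Hom.comp_apply, ha]
  have hb' (x) : h (b x) = cV x := by rw [← Scheme.Hom.comp_apply, hb]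
  have w' (k) : a (kU k) = b (kV k) := by
    rw [← Scheme.Hom.comp_apply, po.w, Scheme.Hom.comp_apply]
  have : IsIso h := by
    refine of_isPullback_of_jointly_surjective (.isomorphisms _) h a b cU cV (𝟙 _) (𝟙 _)
      (isPullback_of_preimage_range_subset _ _ _ _ (by simpa) ?_)
      (isPullback_of_preimage_range_subset _ _ _ _ (by simpa) ?_) hcov
      (inferInstanceAs (IsIso (𝟙 U))) (inferInstanceAs (IsIso (𝟙 V)))
    · rintro x ⟨y, hy⟩
      obtain (⟨z, rfl⟩ | ⟨z, rfl⟩) := cov x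
      · exact ⟨z, rfl⟩
      · rw [hb'] at hy
        obtain ⟨k, rfl, rfl⟩ := exists_eq_eq_of_isPullback sq y z hy
        exact ⟨_, w' k⟩
    · rintro x ⟨y, hy⟩
      obtain (⟨z, rfl⟩ | ⟨z, rfl⟩) := cov x
      · rw [ha'] at hy
        obtain ⟨k, rfl, rfl⟩ := exists_eq_eq_of_isPullback sq z y hy.symm
        exact ⟨_, (w' k).symm⟩
      · exact ⟨z, rfl⟩
  exact po.of_iso (Iso.refl _) (Iso.refl _) (Iso.refl _) (asIso h) (by simp) (by simp)
    (by simpa) (by simpa)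

theorem exists_glue {X U V K U₀ V₀ W : Scheme} {kU : K ⟶ U} {kV : K ⟶ V} {cU : U ⟶ X} {cV : V ⟶ X}
    [IsOpenImmersion cU] [IsOpenImmersion cV] (sq : IsPullback kU kV cU cV)
    (hcov : ∀ x, x ∈ Set.range cU ∨ x ∈ Set.range cV) (i : W ⟶ U₀) (j : W ⟶ V₀)
    [IsOpenImmersion i] [IsOpenImmersion j] (u : U ⟶ U₀) (v : V ⟶ V₀) (q : K ⟶ W)
    (hu : kU ≫ u = q ≫ i) (hv : kV ≫ v = q ≫ j) (Hu : ∀ x, u x ∈ Set.range i → x ∈ Set.range kU)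
    (Hv : ∀ x, v x ∈ Set.range j → x ∈ Set.range kV) :
    ∃ (P : Scheme) (a : U₀ ⟶ P) (b : V₀ ⟶ P) (x : X ⟶ P), IsOpenImmersion a ∧
      IsOpenImmersion b ∧ IsPushout i j a b ∧ (∀ y, y ∈ Set.range a ∨ y ∈ Set.range b) ∧
      (∀ y z, a y = b z → ∃ w, i w = y ∧ j w = z) ∧
      IsPullback cU u x a ∧ IsPullback cV v x b := by
  obtain ⟨P, a, b, _, _, po, cov, inter⟩ := exists_isPushout_of_isOpenImmersion i j
  have pX := isPushout_of_isPullback_of_isOpenImmersion sq hcov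
  let x : X ⟶ P := pX.desc (u ≫ a) (v ≫ b) (by rw [reassoc_of% hu, reassoc_of% hv, po.w])
  have hxU : cU ≫ x = u ≫ a := pX.inl_desc _ _ _
  have hxV : cV ≫ x = v ≫ b := pX.inr_desc _ _ _
  have hxU' (y) : x (cU y) = a (u y) := by
    rw [← Scheme.Hom.comp_apply, hxU, Scheme.Hom.comp_apply]
  have hxV' (y) : x (cV y) = b (v y) := by
    rw [← Scheme.Hom.comp_apply, hxV, Scheme.Hom.comp_apply]
  have w' (k) : cU (kU k) = cV (kV k) := by
    rw [← Scheme.Hom.comp_apply, sq.w, Scheme.Hom.comp_apply]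
  refine ⟨P, a, b, x, inferInstance, inferInstance, po, cov, inter,
    isPullback_of_preimage_range_subset _ _ _ _ hxU ?_,
    isPullback_of_preimage_range_subset _ _ _ _ hxV ?_⟩
  · rintro y ⟨z, hz⟩
    obtain (⟨y, rfl⟩ | ⟨y, rfl⟩) := hcov y
    · exact ⟨y, rfl⟩
    · rw [hxV'] at hz
      obtain ⟨w, -, hw⟩ := inter _ _ hz
      obtain ⟨k, rfl⟩ := Hv y ⟨w, hw⟩
      exact ⟨_, w' k⟩
  · rintro y ⟨z, hz⟩
    obtain (⟨y, rfl⟩ | ⟨y, rfl⟩) := hcov y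
    · rw [hxU'] at hz
      obtain ⟨w, hw, -⟩ := inter _ _ hz.symm
      obtain ⟨k, rfl⟩ := Hu y ⟨w, hw⟩
      exact ⟨_, (w' k).symm⟩
    · exact ⟨y, rfl⟩

theorem exists_glue_of_factors_over_open {X U V K : Scheme} {kU : K ⟶ U} {kV : K ⟶ V}
    {cU : U ⟶ X} {cV : V ⟶ X} [IsOpenImmersion cU] [IsOpenImmersion cV] [IsAffine V]
    (sq : IsPullback kU kV cU cV) (hcov : ∀ x, x ∈ Set.range cU ∨ x ∈ Set.range cV)
    {T W U₀ : Scheme} [IsAffine T] (D : T.Opens) (hD : IsCompact (D : Set T)) (g : V ⟶ T)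
    (p : W ⟶ D.toScheme) [IsAffineHom p] [LocallyOfFiniteType p] (i : W ⟶ U₀)
    [IsOpenImmersion i] (u : U ⟶ U₀) (q : K ⟶ W) (hu : kU ≫ u = q ≫ i)
    (hK : IsPullback kV (q ≫ p) g D.ι) (Hu : ∀ x, u x ∈ Set.range i → x ∈ Set.range kU) :
    ∃ (V₀ P : Scheme) (j : W ⟶ V₀) (t : V₀ ⟶ T) (v : V ⟶ V₀) (a : U₀ ⟶ P) (b : V₀ ⟶ P)
      (x : X ⟶ P), IsAffine V₀ ∧ LocallyOfFiniteType t ∧ IsPullback j p t D.ι ∧ v ≫ t = g ∧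
      IsOpenImmersion a ∧ IsOpenImmersion b ∧ IsPushout i j a b ∧
      (∀ y, y ∈ Set.range a ∨ y ∈ Set.range b) ∧ (∀ y z, a y = b z → ∃ w, i w = y ∧ j w = z) ∧
      IsPullback cU u x a ∧ IsPullback cV v x b := by
  let e := hK.isoIsPullback _ _ (isPullback_morphismRestrict g D).flip
  have he₁ : e.inv ≫ kV = (g ⁻¹ᵁ D).ι := hK.isoIsPullback_inv_fst _ _ _
  have he₂ : e.inv ≫ q ≫ p = g ∣_ D := hK.isoIsPullback_inv_snd _ _ _
  obtain ⟨V₀, _, t, v, j, _, sqj, hv, hq⟩ :=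
    exists_isPullback_of_factors_over_open D hD g p (e.inv ≫ q) (by simpa using he₂)
  have : IsOpenImmersion j := MorphismProperty.of_isPullback sqj.flip inferInstance
  have hv' : kV ≫ v = q ≫ j := by
    rw [← cancel_epi e.inv, reassoc_of% he₁, ← hq, Category.assoc]
  obtain ⟨P, a, b, x, h⟩ := exists_glue sq hcov i j u v q hu hv' Hu (by
    rintro x ⟨w, hw⟩
    have : g x = D.ι (p w) := by
      rw [← hv, Scheme.Hom.comp_apply, ← hw, ← Scheme.Hom.comp_apply, sqj.w,
        Scheme.Hom.comp_apply]
    obtain ⟨k, hk, -⟩ := exists_eq_eq_of_isPullback hK _ _ this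
    exact ⟨k, hk⟩)
  exact ⟨V₀, P, j, t, v, a, b, x, ‹_›, ‹_›, sqj, hv, h⟩

instance isZariskiLocalAtTarget_isAffineHom : IsZariskiLocalAtTarget @IsAffineHom :=
  @HasAffineProperty.instIsZariskiLocalAtTarget @IsAffineHom (fun X _ _ _ ↦ IsAffine X)
    instHasAffinePropertyIsAffineHomIsAffine

instance isZariskiLocalAtTarget_locallyOfFiniteType :
    IsZariskiLocalAtTarget @LocallyOfFiniteType :=
  @HasRingHomProperty.instIsZariskiLocalAtTarget @LocallyOfFiniteType _
    instHasRingHomPropertyLocallyOfFiniteTypeFiniteType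

theorem exists_extend_along_cover {S A V X XA Z : Scheme} (bA : A ⟶ S) (bV : V ⟶ S)
    [IsOpenImmersion bA] [IsOpenImmersion bV] [QuasiCompact bA] [IsAffine V]
    (hcov : ∀ s, s ∈ Set.range bA ∨ s ∈ Set.range bV) {x : X ⟶ S} [IsAffineHom x]
    {cA : XA ⟶ X} {xA : XA ⟶ A} (sqA : IsPullback cA xA x bA) (z : Z ⟶ A) [IsAffineHom z]
    [LocallyOfFiniteType z] (q : XA ⟶ Z) (hq : q ≫ z = xA) :
    ∃ (P : Scheme) (h : P ⟶ S) (x' : X ⟶ P) (a : Z ⟶ P), IsAffineHom h ∧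
      LocallyOfFiniteType h ∧ x' ≫ h = x ∧ IsPullback a z h bA ∧ cA ≫ x' = q ≫ a := by
  let D : V.Opens := bV ⁻¹ᵁ bA.opensRange
  have hD : IsCompact (D : Set V) := by
    have : IsPullback (pullback.fst bV bA) (pullback.snd bV bA) bV bA := .of_hasPullback _ _
    have h : QuasiCompact (pullback.fst bV bA) := inferInstance
    have : CompactSpace ↥(pullback bV bA) :=
      (quasiCompact_iff_compactSpace (f := pullback.fst bV bA)).mp h
    have e : (D : Set V) = Set.range (pullback.fst bV bA) := by
      rw [Scheme.Pullback.range_fst]; rfl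
    rw [e]
    exact isCompact_range (pullback.fst bV bA).continuous
  let dA : D.toScheme ⟶ A := IsOpenImmersion.lift bA (D.ι ≫ bV) (by
    rintro _ ⟨y, rfl⟩
    exact y.2)
  have hdA : dA ≫ bA = D.ι ≫ bV := IsOpenImmersion.lift_fac _ _ _
  have sqD : IsPullback dA D.ι bA bV :=
    (isPullback_of_preimage_range_subset D.ι bV dA bA hdA.symm (by
      rintro y hy
      exact ⟨⟨y, hy⟩, rfl⟩)).flip
  have : IsOpenImmersion dA := MorphismProperty.of_isPullback sqD.flip inferInstance
  let cV := pullback.fst x bV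
  let g := pullback.snd x bV
  have sqV : IsPullback cV g x bV := .of_hasPullback _ _
  have : IsAffine (pullback x bV) := isAffine_of_isAffineHom g
  have : IsOpenImmersion cA := MorphismProperty.of_isPullback sqA.flip inferInstance
  let kA := pullback.fst cA cV
  let kV := pullback.snd cA cV
  have sq : IsPullback kA kV cA cV := .of_hasPullback _ _
  have hcovX (y) : y ∈ Set.range cA ∨ y ∈ Set.range cV := by
    refine (hcov (x y)).imp ?_ ?_
    · rintro ⟨s, hs⟩
      obtain ⟨w, hw, -⟩ := exists_eq_eq_of_isPullback sqA y s hs.symm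
      exact ⟨w, hw⟩
    · rintro ⟨s, hs⟩
      obtain ⟨w, hw, -⟩ := exists_eq_eq_of_isPullback sqV y s hs.symm
      exact ⟨w, hw⟩
  let kD : pullback cA cV ⟶ D.toScheme := sqD.lift (kA ≫ xA) (kV ≫ g) (by
    rw [Category.assoc, Category.assoc, ← sqA.w, ← sqV.w, reassoc_of% sq.w])
  have hkD : kD ≫ dA = kA ≫ xA := sqD.lift_fst _ _ _
  have hkD' : kD ≫ D.ι = kV ≫ g := sqD.lift_snd _ _ _
  have sqK : IsPullback kV kD g D.ι := by
    have h := sq.flip.paste_vert sqA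
    rw [← hkD, sqV.w] at h
    exact h.of_bot hkD'.symm sqD.flip
  let i := pullback.fst z dA
  let p := pullback.snd z dA
  have : IsAffineHom p := 
    MorphismProperty.of_isPullback (P := @IsAffineHom) (.of_hasPullback z dA) ‹_›
  have : LocallyOfFiniteType p := inferInstanceAs (LocallyOfFiniteType (pullback.snd z dA))
  have : IsOpenImmersion i := inferInstanceAs (IsOpenImmersion (pullback.fst z dA))
  have hip : i ≫ z = p ≫ dA := pullback.condition
  let q' : pullback cA cV ⟶ pullback z dA := pullback.lift (kA ≫ q) kD (by
    rw [Category.assoc, hq, hkD])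
  have hq'i : q' ≫ i = kA ≫ q := pullback.lift_fst _ _ _
  have hq'p : q' ≫ p = kD := pullback.lift_snd _ _ _
  obtain ⟨V₀, P, j, t, v, a, b, x', _, _, sqj, hv, _, _, po, cov, inter, sqxA, sqxV⟩ :=
    exists_glue_of_factors_over_open sq hcovX D hD g p i q q' hq'i.symm (by rwa [hq'p]) (by
      rintro y ⟨w, hw⟩
      have h : bA (xA y) = bV (D.ι (p w)) := by
        have h₁ : z (q y) = xA y := congr($hq y)
        have h₂ : z (i w) = dA (p w) := congr($hip w)
        have h₃ : bA (dA (p w)) = bV (D.ι (p w)) := congr($hdA (p w))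
        rw [← h₁, ← hw, h₂, h₃]
      rw [← Scheme.Hom.comp_apply, ← sqA.w, Scheme.Hom.comp_apply] at h
      obtain ⟨r, hr, -⟩ := exists_eq_eq_of_isPullback sqV _ _ h
      obtain ⟨k, hk, -⟩ := exists_eq_eq_of_isPullback sq _ _ hr.symm
      exact ⟨k, hk⟩)
  let h : P ⟶ S := po.desc (z ≫ bA) (t ≫ bV) (by
    rw [reassoc_of% hip, hdA, reassoc_of% sqj.w])
  have ha : a ≫ h = z ≫ bA := po.inl_desc _ _ _
  have hb : b ≫ h = t ≫ bV := po.inr_desc _ _ _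
  have ha' (y) : h (a y) = bA (z y) := by
    rw [← Scheme.Hom.comp_apply, ha, Scheme.Hom.comp_apply]
  have hb' (y) : h (b y) = bV (t y) := by
    rw [← Scheme.Hom.comp_apply, hb, Scheme.Hom.comp_apply]
  have w' (w) : a (i w) = b (j w) := by
    rw [← Scheme.Hom.comp_apply, po.w, Scheme.Hom.comp_apply]
  have sqa : IsPullback a z h bA := by
    refine isPullback_of_preimage_range_subset _ _ _ _ ha ?_
    rintro y ⟨s, hs⟩
    obtain ⟨y, rfl⟩ | ⟨y, rfl⟩ := cov y
    · exact ⟨y, rfl⟩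
    · rw [hb'] at hs
      obtain ⟨d, -, hd⟩ := exists_eq_eq_of_isPullback sqD _ _ hs
      obtain ⟨w, rfl, -⟩ := exists_eq_eq_of_isPullback sqj _ _ hd.symm
      exact ⟨_, w' w⟩
  have sqb : IsPullback b t h bV := by
    refine isPullback_of_preimage_range_subset _ _ _ _ hb ?_
    rintro y ⟨s, hs⟩
    obtain ⟨y, rfl⟩ | ⟨y, rfl⟩ := cov y
    · rw [ha'] at hs
      obtain ⟨d, hd, -⟩ := exists_eq_eq_of_isPullback sqD _ _ hs.symm
      obtain ⟨w, rfl, -⟩ := Scheme.Pullback.exists_preimage_pullback y d hd.symm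
      exact ⟨_, (w' w).symm⟩
    · exact ⟨y, rfl⟩
  refine ⟨P, h, x', a, ?_, ?_, ?_, sqa, sqxA.w⟩
  · exact of_isPullback_of_jointly_surjective @IsAffineHom h a b bA bV z t sqa sqb hcov ‹_›
      inferInstance
  · exact of_isPullback_of_jointly_surjective @LocallyOfFiniteType h a b bA bV z t sqa sqb hcov
      ‹_› ‹_›
  · refine (isPushout_of_isPullback_of_isOpenImmersion sq hcovX).hom_ext ?_ ?_
    · rw [reassoc_of% sqxA.w, ha, reassoc_of% hq, sqA.w]
    · rw [reassoc_of% sqxV.w, hb, reassoc_of% hv, sqV.w]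

theorem isPullback_homOfLE_morphismRestrict {X S : Scheme} (x : X ⟶ S) {A B : S.Opens}
    (h : A ≤ B) : IsPullback (X.homOfLE (x.preimage_mono h)) (x ∣_ A) (x ∣_ B) (S.homOfLE h) := by
  refine IsPullback.of_right (h₁₂ := (x ⁻¹ᵁ B).ι) (h₂₂ := B.ι) (v₁₃ := x) ?_ ?_
    (isPullback_morphismRestrict x B).flip
  · simpa using (isPullback_morphismRestrict x A).flip
  · rw [← cancel_mono B.ι]; simp

theorem exists_extend_of_isCompact {X S Z₀ : Scheme} [CompactSpace S] [QuasiSeparatedSpace S]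
    (x : X ⟶ S) [IsAffineHom x] (U : S.Opens) (hU : IsCompact (U : Set S))
    (z₀ : Z₀ ⟶ U.toScheme) [IsAffineHom z₀] [LocallyOfFiniteType z₀]
    (q₀ : (x ⁻¹ᵁ U).toScheme ⟶ Z₀) (hq₀ : q₀ ≫ z₀ = x ∣_ U) :
    ∃ (Z : Scheme) (z : Z ⟶ S) (q : X ⟶ Z) (m : Z₀ ⟶ Z), IsAffineHom z ∧
      LocallyOfFiniteType z ∧ q ≫ z = x ∧ IsPullback m z₀ z U.ι ∧
      (x ⁻¹ᵁ U).ι ≫ q = q₀ ≫ m := by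
  let P (B : S.Opens) : Prop := ∃ (h : U ≤ B) (Z : Scheme) (z : Z ⟶ B.toScheme)
    (q : (x ⁻¹ᵁ B).toScheme ⟶ Z) (m : Z₀ ⟶ Z), IsAffineHom z ∧ LocallyOfFiniteType z ∧
      q ≫ z = x ∣_ B ∧ IsPullback m z₀ z (S.homOfLE h) ∧
      X.homOfLE (x.preimage_mono h) ≫ q = q₀ ≫ m
  have key : P (U ⊔ ⊤) := by
    refine compact_open_induction_on (P := fun T ↦ P (U ⊔ T)) ⊤ isCompact_univ ?_ ?_
    · rw [sup_bot_eq]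
      exact ⟨le_rfl, Z₀, z₀, q₀, 𝟙 _, ‹_›, ‹_›, hq₀, by simpa using IsPullback.of_id_fst, by simp⟩
    · intro T hT V hP
      rw [← sup_assoc]
      generalize hB : U ⊔ T = B at hP
      obtain ⟨h, Z, z, q, m, _, _, hz, sqm, hq⟩ := hP
      have hBc : CompactSpace B := isCompact_iff_compactSpace.mp (hB ▸ hU.union hT)
      have : IsAffine V.1.toScheme := V.2
      have : QuasiSeparatedSpace (B ⊔ V.1 : S.Opens).toScheme :=
        quasiSeparatedSpace_of_quasiSeparated (B ⊔ V.1).ι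
      have : IsAffineHom (x ∣_ (B ⊔ V.1)) :=
        MorphismProperty.of_isPullback (P := @IsAffineHom)
          (isPullback_morphismRestrict x _).flip ‹_›
      have : QuasiCompact (S.homOfLE (le_sup_left : B ≤ B ⊔ V.1)) := inferInstance
      obtain ⟨P, h', x', a, _, _, hx, sqa, ha⟩ := exists_extend_along_cover
        (S.homOfLE (le_sup_left : B ≤ B ⊔ V.1)) (S.homOfLE (le_sup_right : V.1 ≤ B ⊔ V.1)) (by
          rintro ⟨s, hs⟩
          exact hs.imp (fun h ↦ ⟨⟨s, h⟩, Subtype.ext (by simp)⟩)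
            (fun h ↦ ⟨⟨s, h⟩, Subtype.ext (by simp)⟩))
        (isPullback_homOfLE_morphismRestrict x le_sup_left) z q hz
      refine ⟨h.trans le_sup_left, P, h', x', m ≫ a, ‹_›, ‹_›, hx, ?_, ?_⟩
      · simpa using sqm.paste_horiz sqa
      · rw [← Scheme.homOfLE_homOfLE X (x.preimage_mono h) (x.preimage_mono le_sup_left),
          Category.assoc, ha, reassoc_of% hq]
  rw [sup_top_eq] at key
  obtain ⟨h, Z, z, q, m, _, _, hz, sqm, hq⟩ := key
  let e : (x ⁻¹ᵁ ⊤).toScheme ⟶ X := (x ⁻¹ᵁ ⊤).ι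
  have : IsIso e := inferInstanceAs (IsIso X.topIso.hom)
  have : IsIso (⊤ : S.Opens).ι := inferInstanceAs (IsIso S.topIso.hom)
  refine ⟨Z, z ≫ (⊤ : S.Opens).ι, inv e ≫ q, m, inferInstance, inferInstance, ?_, ?_, ?_⟩
  · rw [Category.assoc, reassoc_of% hz, IsIso.inv_comp_eq]
    exact morphismRestrict_ι x ⊤
  · simpa using sqm.paste_horiz (IsPullback.of_horiz_isIso (fst := 𝟙 Z) (snd := z)
      (f := z ≫ (⊤ : S.Opens).ι) (g := (⊤ : S.Opens).ι) ⟨by simp⟩)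
  · rw [← hq, ← Category.assoc]
    congr 1
    rw [← cancel_mono e]
    simp only [Category.assoc, IsIso.inv_hom_id, Category.comp_id]
    exact (Scheme.homOfLE_ι _ _).symm

theorem exists_appLE_eq_of_isAffineHom.{u} {X S : Scheme.{u}} [CompactSpace S]
    [QuasiSeparatedSpace S]
    (x : X ⟶ S) [IsAffineHom x] (U : S.Opens) (hU : IsCompact (U : Set S))
    (a : Γ(X, x ⁻¹ᵁ U)) :
    ∃ (Z : Scheme) (z : Z ⟶ S) (q : X ⟶ Z), IsAffineHom z ∧ LocallyOfFiniteType z ∧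
      q ≫ z = x ∧ ∃ (h : x ⁻¹ᵁ U ≤ q ⁻¹ᵁ z ⁻¹ᵁ U) (b : Γ(Z, z ⁻¹ᵁ U)),
        q.appLE (z ⁻¹ᵁ U) (x ⁻¹ᵁ U) h b = a := by
  let a' : Γ((x ⁻¹ᵁ U).toScheme, ⊤) := (x ⁻¹ᵁ U).ι.appLE (x ⁻¹ᵁ U) ⊤ (by simp) a
  let q₀ : (x ⁻¹ᵁ U).toScheme ⟶ 𝔸(PUnit.{u + 1}; U.toScheme) :=
    AffineSpace.homOfVector (x ∣_ U) (fun _ ↦ a')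
  obtain ⟨Z, z, q, m, hz, hz', hq, sq, hm⟩ := exists_extend_of_isCompact x U hU
    (𝔸(PUnit.{u + 1}; U.toScheme) ↘ U.toScheme) q₀ (AffineSpace.homOfVector_over _ _)
  have h : x ⁻¹ᵁ U ≤ q ⁻¹ᵁ z ⁻¹ᵁ U := by rw [← Scheme.Hom.comp_preimage, hq]
  have : IsOpenImmersion m := MorphismProperty.of_isPullback sq.flip inferInstance
  have hle : z ⁻¹ᵁ U ≤ m.opensRange := by
    intro y hy
    obtain ⟨k, hk, -⟩ := exists_eq_eq_of_isPullback sq y ⟨z y, hy⟩ rfl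
    exact ⟨k, hk⟩
  have hm' : ⊤ ≤ m ⁻¹ᵁ z ⁻¹ᵁ U := by
    rw [← Scheme.Hom.comp_preimage, sq.w]; simp
  have hmt : m ⁻¹ᵁ z ⁻¹ᵁ U = ⊤ := top_le_iff.mp hm'
  have : IsIso (m.app (z ⁻¹ᵁ U)) := m.isIso_app _ hle
  have : IsIso (m.appLE (z ⁻¹ᵁ U) ⊤ hm') := by
    rw [Scheme.Hom.appLE]
    have : IsIso ((𝔸(PUnit.{u + 1}; U.toScheme)).presheaf.map (homOfLE hm').op) := by
      rw [show (homOfLE hm') = (eqToIso hmt.symm).hom from rfl]; infer_instance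
    infer_instance
  obtain ⟨b, hb⟩ := (ConcreteCategory.bijective_of_isIso (m.appLE (z ⁻¹ᵁ U) ⊤ hm')).2
    (AffineSpace.coord _ PUnit.unit)
  refine ⟨Z, z, q, hz, hz', hq, h, b, ?_⟩
  have hinj : Function.Injective ((x ⁻¹ᵁ U).ι.appLE (x ⁻¹ᵁ U) ⊤ (by simp)) := by
    have : IsIso ((x ⁻¹ᵁ U).ι.appLE (x ⁻¹ᵁ U) ⊤ (by simp)) := by
      rw [Scheme.Hom.appLE]
      have := (x ⁻¹ᵁ U).ι.isIso_app (x ⁻¹ᵁ U) (by simp)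
      have : IsIso ((x ⁻¹ᵁ U).toScheme.presheaf.map
          (homOfLE (show ⊤ ≤ (x ⁻¹ᵁ U).ι ⁻¹ᵁ (x ⁻¹ᵁ U) by simp)).op) := by
        rw [show (homOfLE _) = (eqToIso (show ⊤ = (x ⁻¹ᵁ U).ι ⁻¹ᵁ (x ⁻¹ᵁ U) by simp)).hom from rfl]
        infer_instance
      infer_instance
    exact (ConcreteCategory.bijective_of_isIso _).1
  apply hinj
  have e₁ := Scheme.Hom.appLE_comp_appLE (x ⁻¹ᵁ U).ι q (z ⁻¹ᵁ U) (x ⁻¹ᵁ U) ⊤ h (by simp)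
  have e₂ := Scheme.Hom.appLE_comp_appLE q₀ m (z ⁻¹ᵁ U) ⊤ ⊤ hm' (by simp)
  have e₃ : q₀.appLE ⊤ ⊤ (by simp) (AffineSpace.coord _ PUnit.unit) = a' := by
    refine Eq.trans ?_ (AffineSpace.homOfVector_appTop_coord (x ∣_ U)
      (fun _ : PUnit.{u + 1} ↦ a') PUnit.unit)
    exact congr($(q₀.appLE_eq_app (U := ⊤)) _)
  have e₄ : ∀ (f g : (x ⁻¹ᵁ U).toScheme ⟶ Z) (hfg : f = g) (hf) (hg),
    f.appLE (z ⁻¹ᵁ U) ⊤ hf = g.appLE (z ⁻¹ᵁ U) ⊤ hg := by rintro f _ rfl _ _; rfl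
  have e₅ := (e₁.trans (e₄ _ _ hm _ _)).trans e₂.symm
  have := congr($e₅ b)
  simp only [CommRingCat.comp_apply] at this
  rw [this, hb, e₃]

theorem toSpecΓ_map_appLE_fromSpec {T Z : Scheme} (t : T ⟶ Z) {V : Z.Opens} (hV : IsAffineOpen V)
    (W : T.Opens) (h : W ≤ t ⁻¹ᵁ V) :
    W.toSpecΓ ≫ Spec.map (t.appLE V W h) ≫ hV.fromSpec = W.ι ≫ t := by
  rw [Scheme.Opens.toSpecΓ_SpecMap_appLE_assoc, IsAffineOpen.toSpecΓ_fromSpec]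
  simp [Scheme.Hom.resLE]

theorem isOpenCover_preimage_affineOpens {T S : Scheme} (t : T ⟶ S) :
    TopologicalSpace.IsOpenCover fun U : S.affineOpens ↦ t ⁻¹ᵁ U.1 := by
  rw [TopologicalSpace.IsOpenCover, ← Scheme.Hom.preimage_iSup, iSup_affineOpens_eq_top,
    Scheme.Hom.preimage_top]

theorem ext_of_appLE_eq {T X S : Scheme} {x : X ⟶ S} [IsAffineHom x] {l l' : T ⟶ X} {t : T ⟶ S}
    (h : l ≫ x = t) (h' : l' ≫ x = t)
    (H : ∀ (U : S.Opens) (_ : IsAffineOpen U) (hW : t ⁻¹ᵁ U ≤ l ⁻¹ᵁ x ⁻¹ᵁ U)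
      (hW' : t ⁻¹ᵁ U ≤ l' ⁻¹ᵁ x ⁻¹ᵁ U), l.appLE (x ⁻¹ᵁ U) _ hW = l'.appLE (x ⁻¹ᵁ U) _ hW') :
    l = l' := by
  refine Scheme.Cover.hom_ext (T.openCoverOfIsOpenCover _ (isOpenCover_preimage_affineOpens t))
    _ _ fun (U : S.affineOpens) ↦ ?_
  change (t ⁻¹ᵁ U.1).ι ≫ l = (t ⁻¹ᵁ U.1).ι ≫ l'
  have hW : t ⁻¹ᵁ U.1 ≤ l ⁻¹ᵁ x ⁻¹ᵁ U.1 := by rw [← Scheme.Hom.comp_preimage, h]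
  have hW' : t ⁻¹ᵁ U.1 ≤ l' ⁻¹ᵁ x ⁻¹ᵁ U.1 := by rw [← Scheme.Hom.comp_preimage, h']
  rw [← toSpecΓ_map_appLE_fromSpec l (U.2.preimage x) _ hW,
    ← toSpecΓ_map_appLE_fromSpec l' (U.2.preimage x) _ hW', H U U.2 hW hW']

/-- For an open `U` of `S`, the functor sending an `S`-scheme `A` to the ring of functions on the
preimage of `U` in `A`. -/
@[simps]
def overSections {S : Scheme} (U : S.Opens) : (Over S)ᵒᵖ ⥤ CommRingCat where
  obj A := Γ(A.unop.left, A.unop.hom ⁻¹ᵁ U)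
  map f := f.unop.left.appLE _ _ (by rw [← Scheme.Hom.comp_preimage, Over.w])
  map_id A := by
    simp only [Scheme.Hom.appLE, unop_id, Over.id_left, Scheme.Hom.id_app]
    exact (Category.id_comp _).trans (A.unop.left.presheaf.map_id _)
  map_comp f g := by simp [Scheme.Hom.appLE_comp_appLE]

theorem over_hom_ext_of_overSections {S : Scheme} {T B : Over S} [IsAffineHom B.hom] {l l' : T ⟶ B}
    (H : ∀ U : S.Opens, IsAffineOpen U → (overSections U).map l.op = (overSections U).map l'.op) :
    l = l' := by
  ext1
  exact ext_of_appLE_eq (x := B.hom) (t := T.hom) (by simp) (by simp) fun U hU _ _ ↦ H U hU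

/-- A cone of affine `S`-schemes is a limit cone as soon as, over each affine open of `S`, the
ring of functions of the apex is the directed union of the rings of functions of the diagram. -/
theorem nonempty_isLimit_of_overSections.{u} {S : Scheme.{u}} {I : Type u} [SmallCategory I]
    [IsCofiltered I] {D : I ⥤ Over S} (c : Cone D) [IsAffineHom c.pt.hom]
    (hD : ∀ i, IsAffineHom (D.obj i).hom)
    (hinj : ∀ U : S.Opens, IsAffineOpen U → ∀ i,
      Function.Injective ((overSections U).map (c.π.app i).op))
    (hsurj : ∀ U : S.Opens, IsAffineOpen U → ∀ a : Γ(c.pt.left, c.pt.hom ⁻¹ᵁ U), ∃ i b,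
      (overSections U).map (c.π.app i).op b = a) : Nonempty (IsLimit c) := by
  have hcolim (U : S.Opens) (hU : IsAffineOpen U) :
      Nonempty (IsColimit ((overSections U).mapCocone c.op)) := by
    have : ReflectsColimitsOfShape Iᵒᵖ (forget CommRingCat.{u}) :=
      reflectsColimitsOfShape_of_reflectsIsomorphisms
    refine ⟨isColimitOfReflects (forget CommRingCat) (Types.FilteredColimit.isColimitOf _ _ ?_ ?_)⟩
    · intro a
      obtain ⟨i, b, rfl⟩ := hsurj U hU a
      exact ⟨.op i, b, rfl⟩
    · intro i j a b hab
      let k := IsFiltered.max i j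
      refine ⟨k, IsFiltered.leftToMax i j, IsFiltered.rightToMax i j, hinj U hU k.unop ?_⟩
      refine Eq.trans ?_ (hab.trans ?_)
      · exact congr($(((overSections U).mapCocone c.op).w (IsFiltered.leftToMax i j)) a)
      · exact congr($(((overSections U).mapCocone c.op).w (IsFiltered.rightToMax i j)) b).symm
  have hext {T : Over S} {l l' : T ⟶ c.pt} (h : ∀ i, l ≫ c.π.app i = l' ≫ c.π.app i) : l = l' := by
    refine over_hom_ext_of_overSections fun U hU ↦ ?_
    ext a
    obtain ⟨i, b, rfl⟩ := hsurj U hU a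
    have := congr((overSections U).map ($(h i)).op b)
    rw [op_comp, op_comp, Functor.map_comp, Functor.map_comp] at this
    exact this
  have hlift (s : Cone D) (U : S.Opens) (hU : IsAffineOpen U) :
      ∃ l : Over.mk ((s.pt.hom ⁻¹ᵁ U).ι ≫ s.pt.hom) ⟶ c.pt, ∀ i,
        l ≫ c.π.app i = Over.homMk (s.pt.hom ⁻¹ᵁ U).ι ≫ s.π.app i := by
    obtain ⟨hc⟩ := hcolim U hU
    have hle {A B : Over S} (f : A ⟶ B) : A.hom ⁻¹ᵁ U ≤ f.left ⁻¹ᵁ B.hom ⁻¹ᵁ U := by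
      rw [← Scheme.Hom.comp_preimage, Over.w]
    obtain ⟨φ, hφ⟩ : ∃ φ : Γ(c.pt.left, c.pt.hom ⁻¹ᵁ U) ⟶ Γ(s.pt.left, s.pt.hom ⁻¹ᵁ U),
        ∀ i, Scheme.Hom.appLE (X := c.pt.left) (c.π.app i).left _ _ (hle (A := c.pt) _) ≫ φ =
          Scheme.Hom.appLE (X := s.pt.left) (s.π.app i).left _ _ (hle (A := s.pt) _) :=
      ⟨hc.desc ((overSections U).mapCocone s.op),
        fun i ↦ hc.fac ((overSections U).mapCocone s.op) (.op i)⟩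
    let l := (s.pt.hom ⁻¹ᵁ U).toSpecΓ ≫ Spec.map φ ≫ (hU.preimage c.pt.hom).fromSpec
    have hl (i) : l ≫ (c.π.app i).left = (s.pt.hom ⁻¹ᵁ U).ι ≫ (s.π.app i).left := by
      have := hD i
      rw [← toSpecΓ_map_appLE_fromSpec (T := s.pt.left) (s.π.app i).left
        (hU.preimage (D.obj i).hom) _ (hle (A := s.pt) _)]
      simp only [l, Category.assoc]
      rw [← IsAffineOpen.SpecMap_appLE_fromSpec (X := c.pt.left) (c.π.app i).left
        (hU.preimage (D.obj i).hom) (hU.preimage c.pt.hom) (hle (A := c.pt) _),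
        ← Spec.map_comp_assoc, hφ]
    obtain ⟨i⟩ : Nonempty I := IsCofiltered.nonempty
    refine ⟨Over.homMk l ?_, fun i ↦ by ext1; exact hl i⟩
    rw [← Over.w (f := c.pt) (c.π.app i), reassoc_of% hl i]
    exact congr(_ ≫ $(Over.w (f := s.pt) (s.π.app i)))
  choose l hl using fun s (U : S.affineOpens) ↦ hlift s U.1 U.2
  let 𝒰 (s : Cone D) := s.pt.left.openCoverOfIsOpenCover _
    (isOpenCover_preimage_affineOpens s.pt.hom)
  have hglue (s : Cone D) (U V : S.affineOpens) :
      pullback.fst ((𝒰 s).f U) ((𝒰 s).f V) ≫ (l s U).left =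
        pullback.snd ((𝒰 s).f U) ((𝒰 s).f V) ≫ (l s V).left := by
    let T : Over S := Over.mk (pullback.fst ((𝒰 s).f U) ((𝒰 s).f V) ≫ (𝒰 s).f U ≫ s.pt.hom)
    let p : T ⟶ Over.mk ((s.pt.hom ⁻¹ᵁ U.1).ι ≫ s.pt.hom) :=
      Over.homMk (pullback.fst ((𝒰 s).f U) ((𝒰 s).f V)) rfl
    let q : T ⟶ Over.mk ((s.pt.hom ⁻¹ᵁ V.1).ι ≫ s.pt.hom) :=
      Over.homMk (pullback.snd ((𝒰 s).f U) ((𝒰 s).f V)) (pullback.condition_assoc _).symm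
    refine congr(($(hext (l := p ≫ l s U) (l' := q ≫ l s V) fun i ↦ ?_)).left)
    rw [Category.assoc, Category.assoc, hl, hl, ← Category.assoc, ← Category.assoc]
    congr 1
    ext1
    exact pullback.condition
  let L (s : Cone D) : s.pt.left ⟶ c.pt.left :=
    (𝒰 s).glueMorphisms (fun U ↦ (l s U).left) (hglue s)
  have hL (s : Cone D) (U : S.affineOpens) : (s.pt.hom ⁻¹ᵁ U.1).ι ≫ L s = (l s U).left :=
    (𝒰 s).ι_glueMorphisms _ (hglue s) U
  have hLπ (s : Cone D) (i) : L s ≫ (c.π.app i).left = (s.π.app i).left := by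
    refine (𝒰 s).hom_ext _ _ fun (U : S.affineOpens) ↦ ?_
    refine (Category.assoc _ _ _).symm.trans ?_
    refine (congr($(hL s U) ≫ _)).trans ?_
    exact congr(($(hl s U i)).left)
  have hLS (s : Cone D) : L s ≫ c.pt.hom = s.pt.hom := by
    obtain ⟨i⟩ : Nonempty I := IsCofiltered.nonempty
    rw [← Over.w (f := c.pt) (c.π.app i), reassoc_of% hLπ s i]
    exact Over.w (f := s.pt) (s.π.app i)
  have hLπ' (s : Cone D) (i) : Over.homMk (L s) (hLS s) ≫ c.π.app i = s.π.app i := by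
    ext1
    exact hLπ s i
  exact ⟨{ lift s := Over.homMk (L s) (hLS s)
           fac s i := hLπ' s i
           uniq s m hm := hext fun i ↦ (hm i).trans (hLπ' s i).symm }⟩

theorem isAffineHom_left_of_hom {S : Scheme} {A B : Over S} (f : A ⟶ B) (hA : IsAffineHom A.hom)
    [IsSeparated B.hom] : IsAffineHom f.left := by
  have : IsAffineHom (f.left ≫ B.hom) := by rwa [Over.w]
  exact .of_comp f.left B.hom

/-- The objects under an `S`-scheme `T` that are affine and locally of finite type over `S` and
to which `T` maps scheme-theoretically dominantly. -/
def dominantAffine.{u} {S : Scheme.{u}} (T : Over S) : ObjectProperty (Under T) := fun A ↦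
  IsAffineHom A.right.hom ∧ LocallyOfFiniteType A.right.hom ∧ ∀ U : S.Opens, IsAffineOpen U →
    Function.Injective ((overSections U).map A.hom.op)

theorem exists_dominantAffine_hom.{u} {S : Scheme.{u}} {T : Over S} (hT : IsAffineHom T.hom)
    (A : Under T) (hA : IsAffineHom A.right.hom) (hA' : LocallyOfFiniteType A.right.hom) :
    ∃ B, dominantAffine T B ∧ Nonempty (B ⟶ A) := by
  have : IsAffineHom A.hom.left := isAffineHom_left_of_hom _ hT
  let g : T.left ⟶ A.right.left := A.hom.left
  let B : Under T := Under.mk (Y := Over.mk (g.imageι ≫ A.right.hom))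
    (Over.homMk g.toImage (by
      refine (Scheme.Hom.toImage_imageι_assoc g _).trans ?_
      exact Over.w A.hom))
  refine ⟨B, ⟨?_, ?_, fun U hU ↦ ?_⟩, ⟨Under.homMk (Over.homMk g.imageι) ?_⟩⟩
  · exact inferInstanceAs (IsAffineHom (g.imageι ≫ A.right.hom))
  · exact inferInstanceAs (LocallyOfFiniteType (g.imageι ≫ A.right.hom))
  · have h₁ := g.toImage_app_injective ⟨_, hU.preimage A.right.hom⟩
    have h₂ : T.hom ⁻¹ᵁ U = g.toImage ⁻¹ᵁ g.imageι ⁻¹ᵁ A.right.hom ⁻¹ᵁ U := by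
      rw [← Scheme.Hom.comp_preimage, ← Scheme.Hom.comp_preimage, g.toImage_imageι]
      exact congr($(Over.w A.hom) ⁻¹ᵁ U).symm
    have h₃ : (overSections U).map B.hom.op =
      g.toImage.app (g.imageι ⁻¹ᵁ A.right.hom ⁻¹ᵁ U) ≫
        T.left.presheaf.map (eqToIso h₂).op.hom := rfl
    rw [h₃]
    exact (ConcreteCategory.bijective_of_isIso
      (T.left.presheaf.map (eqToIso h₂).op.hom)).1.comp h₁
  · ext1
    exact g.toImage_imageι

theorem subsingleton_under_hom.{u} {S : Scheme.{u}} {T : Over S} {A B : Under T}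
    (hA : dominantAffine T A) (hB : IsAffineHom B.right.hom) : Subsingleton (A ⟶ B) := by
  refine ⟨fun f g ↦ ?_⟩
  ext1
  refine over_hom_ext_of_overSections fun U hU ↦ ?_
  ext a
  apply hA.2.2 U hU
  have h (f : A ⟶ B) : (overSections U).map A.hom.op ((overSections U).map f.right.op a) =
      (overSections U).map B.hom.op a := by
    rw [← Under.w f, op_comp, Functor.map_comp]; rfl
  rw [h, h]

theorem isCofiltered_dominantAffine.{u} {S : Scheme.{u}} {T : Over S} (hT : IsAffineHom T.hom) :
    IsCofiltered (dominantAffine T).FullSubcategory where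
  cone_objs A B := by
    have := A.2.1
    have := B.2.1
    have := A.2.2.1
    have := B.2.2.1
    let p := pullback.fst A.1.right.hom B.1.right.hom
    have : IsAffineHom p := MorphismProperty.of_isPullback (P := @IsAffineHom)
      (IsPullback.of_hasPullback A.1.right.hom B.1.right.hom).flip ‹_›
    have : LocallyOfFiniteType p := inferInstanceAs (LocallyOfFiniteType (pullback.fst _ _))
    let C : Under T := Under.mk (Y := Over.mk (p ≫ A.1.right.hom)) (Over.homMk
      (pullback.lift A.1.hom.left B.1.hom.left
        ((Over.w A.1.hom).trans (Over.w B.1.hom).symm)) (by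
      refine (pullback.lift_fst_assoc _ _ _ _).trans ?_
      exact Over.w A.1.hom))
    obtain ⟨D, hD, ⟨f⟩⟩ := exists_dominantAffine_hom hT C
      (inferInstanceAs (IsAffineHom (p ≫ A.1.right.hom)))
      (inferInstanceAs (LocallyOfFiniteType (p ≫ A.1.right.hom)))
    refine ⟨⟨D, hD⟩, ⟨f ≫ Under.homMk (Over.homMk p) ?_⟩,
      ⟨f ≫ Under.homMk (Over.homMk (pullback.snd _ _) pullback.condition.symm) ?_⟩, trivial⟩
    · ext1; exact pullback.lift_fst _ _ _
    · ext1; exact pullback.lift_snd _ _ _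
  cone_maps A B f g := by
    have := subsingleton_under_hom A.2 B.2.1
    exact ⟨A, 𝟙 _, by ext1; exact Subsingleton.elim _ _⟩
  nonempty := by
    obtain ⟨B, hB, -⟩ := exists_dominantAffine_hom hT (Under.mk (Over.mkIdTerminal.from T))
      (inferInstanceAs (IsAffineHom (𝟙 S))) (inferInstanceAs (LocallyOfFiniteType (𝟙 S)))
    exact ⟨⟨B, hB⟩⟩

/-- A scheme affine over a quasi-compact quasi-separated scheme `S` is a cofiltered limit of
schemes affine and of finite type over `S`. -/
theorem exists_isLimit_of_isAffineHom.{u} {X S : Scheme.{u}} [CompactSpace S]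
    [QuasiSeparatedSpace S] (x : X ⟶ S) [hx : IsAffineHom x] :
    ∃ (I : Type u) (_ : SmallCategory I) (_ : IsCofiltered I) (D : I ⥤ Over S)
      (π : (Functor.const I).obj (Over.mk x) ⟶ D),
      (∀ i, IsAffineHom (D.obj i).hom ∧ LocallyOfFiniteType (D.obj i).hom) ∧
      Nonempty (IsLimit (⟨Over.mk x, π⟩ : Cone D)) := by
  let P := dominantAffine (Over.mk x)
  have : IsCofiltered P.FullSubcategory := isCofiltered_dominantAffine hx
  have H (k : Σ U : S.affineOpens, Γ(X, x ⁻¹ᵁ U.1)) : ∃ (A : P.FullSubcategory) (b : _),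
      (overSections k.1.1).map A.1.hom.op b = k.2 := by
    obtain ⟨⟨U, hU⟩, a⟩ := k
    obtain ⟨Z, z, q, hz, hz', hq, h, b, hb⟩ := exists_appLE_eq_of_isAffineHom x U hU.isCompact a
    obtain ⟨B, hB, ⟨f⟩⟩ := exists_dominantAffine_hom (T := Over.mk x) hx
      (Under.mk (Y := Over.mk z) (Over.homMk q)) hz hz'
    refine ⟨⟨B, hB⟩, (overSections U).map f.right.op b, ?_⟩
    have := congr($((overSections U).map_comp f.right.op B.hom.op) b)
    refine this.symm.trans ?_
    rw [← op_comp, Under.w f]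
    exact hb
  choose A b hb using H
  let F := Discrete.functor A
  have : Nonempty (Discrete (Σ U : S.affineOpens, Γ(X, x ⁻¹ᵁ U.1))) :=
    ⟨⟨⟨⟨⊥, isAffineOpen_bot S⟩, 0⟩⟩⟩
  let i := IsCofiltered.SmallCofilteredIntermediate.inclusion F
  refine ⟨IsCofiltered.SmallCofilteredIntermediate F, inferInstance, inferInstance,
    i ⋙ P.ι ⋙ Under.forget _, { app j := (i.obj j).1.hom, naturality := ?_ },
    fun j ↦ ⟨(i.obj j).2.1, (i.obj j).2.2.1⟩, ?_⟩
  · intro j k f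
    simp
  · have : IsAffineHom (Over.mk x).hom := hx
    refine nonempty_isLimit_of_overSections (c := ⟨Over.mk x, _⟩) (fun j ↦ (i.obj j).2.1)
      (fun U hU j ↦ (i.obj j).2.2.2 U hU) fun U hU a ↦ ?_
    let j := (IsCofiltered.SmallCofilteredIntermediate.factoring F).obj ⟨⟨⟨U, hU⟩, a⟩⟩
    let e : i.obj j ⟶ A ⟨⟨U, hU⟩, a⟩ :=
      (IsCofiltered.SmallCofilteredIntermediate.factoringCompInclusion F).hom.app
      ⟨⟨⟨U, hU⟩, a⟩⟩
    refine ⟨j, (overSections U).map e.hom.right.op (b ⟨⟨U, hU⟩, a⟩), ?_⟩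
    refine Eq.trans ?_ (hb ⟨⟨U, hU⟩, a⟩)
    have := congr($((overSections U).map_comp e.hom.right.op (i.obj j).1.hom.op)
      (b ⟨⟨U, hU⟩, a⟩))
    refine this.symm.trans ?_
    exact congr((overSections U).map ($(Under.w e.hom)).op (b ⟨⟨U, hU⟩, a⟩))

/-- A scheme affine over a scheme `X₀` of finite type over a Noetherian scheme `S` is a cofiltered
limit of schemes of finite type over `S` along affine transition maps. -/
theorem exists_isLimit_over.{u} {X X₀ S : Scheme.{u}} [IsNoetherian S] (a : X ⟶ X₀)
    (s : X₀ ⟶ S) [IsAffineHom a] [LocallyOfFiniteType s] [QuasiCompact s] :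
    ∃ (I : Type u) (_ : SmallCategory I) (_ : IsCofiltered I) (D : I ⥤ Over S)
      (π : (Functor.const I).obj (Over.mk (a ≫ s)) ⟶ D),
      (∀ i, LocallyOfFiniteType (D.obj i).hom ∧ QuasiCompact (D.obj i).hom) ∧
      (∀ (i j : I) (φ : i ⟶ j), IsAffineHom (D.map φ).left) ∧
      Nonempty (IsLimit (⟨Over.mk (a ≫ s), π⟩ : Cone D)) := by
  have : CompactSpace X₀ := QuasiCompact.compactSpace_of_compactSpace s
  have : IsLocallyNoetherian X₀ := LocallyOfFiniteType.isLocallyNoetherian s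
  obtain ⟨I, _, _, D, π, hD, ⟨hc⟩⟩ := exists_isLimit_of_isAffineHom a
  have : IsConnected I := IsCofiltered.isConnected I
  let c : Cone D := ⟨Over.mk a, π⟩
  refine ⟨I, inferInstance, inferInstance, D ⋙ Over.map s,
    { app := fun i ↦ (Over.map s).map (π.app i), naturality := ?_ }, fun i ↦ ?_,
    fun i j φ ↦ ?_, ⟨?_⟩⟩
  · intro i j f
    exact ((Over.map s).mapCone c).π.naturality f
  · obtain ⟨_, _⟩ := hD i
    exact ⟨inferInstanceAs (LocallyOfFiniteType ((D.obj i).hom ≫ s)),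
      inferInstanceAs (QuasiCompact ((D.obj i).hom ≫ s))⟩
  · have := (hD j).1
    exact isAffineHom_left_of_hom (D.map φ) (hD i).1
  · have h : IsLimit ((Over.forget X₀).mapCone c) := isLimitOfPreserves (Over.forget X₀) hc
    exact isLimitOfReflects (Over.forget S) h

theorem exists_isAffineHom_map_comp.{u} {I : Type u} [SmallCategory I] [IsCofiltered I]
    (D : I ⥤ Scheme.{u}) [∀ {i j} (f : i ⟶ j), IsAffineHom (D.map f)]
    [∀ i, CompactSpace (D.obj i)] [∀ i, QuasiSeparatedSpace (D.obj i)] (c : Cone D)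
    (hc : IsLimit c) {T : Scheme.{u}} [CompactSpace T] [QuasiSeparatedSpace T] {i : I}
    (w : D.obj i ⟶ T) (hw : IsAffineHom (c.π.app i ≫ w)) :
    ∃ (j : I) (f : j ⟶ i), IsAffineHom (D.map f ≫ w) := by
  have key (V : T.Opens) (hV : IsAffineOpen V) :
      ∃ (j : I) (f : j ⟶ i), IsAffineOpen ((D.map f ≫ w) ⁻¹ᵁ V) := by
    have hU := QuasiCompact.isCompact_preimage (f := w) _ V.2 hV.isCompact
    have (j : Over i) : CompactSpace ((opensDiagram D i (w ⁻¹ᵁ V)).obj j) :=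
      isCompact_iff_compactSpace.mp (QuasiCompact.isCompact_preimage _ (w ⁻¹ᵁ V).2 hU)
    have (j : Over i) : QuasiSeparatedSpace ((opensDiagram D i (w ⁻¹ᵁ V)).obj j) :=
      (isQuasiSeparated_iff_quasiSeparatedSpace _ (D.map _ ⁻¹ᵁ _).2).mp (.of_quasiSeparatedSpace _)
    have : IsAffine (opensCone D c i (w ⁻¹ᵁ V)).pt := hV.preimage (c.π.app i ≫ w)
    obtain ⟨j, hj⟩ := Scheme.exists_isAffine_of_isLimit _ _ (isLimitOpensCone D c hc i (w ⁻¹ᵁ V))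
    exact ⟨j.left, j.hom, hj⟩
  let 𝒱 := T.affineCover.finiteSubcover
  choose j f hf using fun x : 𝒱.I₀ ↦ key (𝒱.f x).opensRange (isAffineOpen_opensRange _)
  obtain ⟨k, fk, g, hk⟩ := IsCofiltered.wideCospan f
  refine ⟨k, fk, isAffineHom_of_forall_exists_isAffineOpen _ fun y ↦
    ⟨(𝒱.f (𝒱.idx y)).opensRange, 𝒱.covers y, isAffineOpen_opensRange _, ?_⟩⟩
  rw [← hk (𝒱.idx y), D.map_comp, Category.assoc, Scheme.Hom.comp_preimage]
  exact (hf _).preimage _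

theorem exists_isPullback_of_isLimit.{u} {I : Type u} [SmallCategory I] [IsCofiltered I]
    (D : I ⥤ Scheme.{u}) [∀ {i j} (f : i ⟶ j), IsAffineHom (D.map f)]
    [∀ i, CompactSpace (D.obj i)] [∀ i, QuasiSeparatedSpace (D.obj i)] (c : Cone D)
    (hc : IsLimit c) {S : Scheme.{u}} (t : D ⟶ (Functor.const I).obj S) {K T : Scheme.{u}}
    (k : K ⟶ c.pt) [IsOpenImmersion k] [CompactSpace K] [CompactSpace T] [QuasiSeparatedSpace T]
    (h : K ⟶ T) [IsAffineHom h] (s : T ⟶ S) [LocallyOfFinitePresentation s]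
    (H : ∀ i, k ≫ c.π.app i ≫ t.app i = h ≫ s) :
    ∃ (i : I) (W : (D.obj i).Opens) (p : W.toScheme ⟶ T) (q : K ⟶ W.toScheme),
      IsAffineHom p ∧ p ≫ s = W.ι ≫ t.app i ∧ q ≫ p = h ∧ IsPullback q k W.ι (c.π.app i) := by
  obtain ⟨i, W, hW, hWk⟩ := exists_preimage_eq D c hc k.opensRange (isCompact_range k.continuous)
  have (j : Over i) : CompactSpace ((opensDiagram D i W).obj j) :=
    isCompact_iff_compactSpace.mp (QuasiCompact.isCompact_preimage _ W.2 hW)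
  have (j : Over i) : QuasiSeparatedSpace ((opensDiagram D i W).obj j) :=
    (isQuasiSeparated_iff_quasiSeparatedSpace _ (D.map _ ⁻¹ᵁ _).2).mp (.of_quasiSeparatedSpace _)
  let e : (c.π.app i ⁻¹ᵁ W).toScheme ≅ K :=
    IsOpenImmersion.isoOfRangeEq (c.π.app i ⁻¹ᵁ W).ι k (by rw [Scheme.Opens.range_ι, hWk]; rfl)
  have he : e.hom ≫ k = (c.π.app i ⁻¹ᵁ W).ι := IsOpenImmersion.isoOfRangeEq_hom_fac _ _ _
  have ha : IsAffineHom (e.hom ≫ h) := inferInstance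
  let t' : opensDiagram D i W ⟶ (Functor.const (Over i)).obj S :=
    opensDiagramι D i W ≫ Functor.whiskerLeft (Over.forget i) t
  let c' := opensCone D c i W
  have hc' : IsLimit c' := isLimitOpensCone D c hc i W
  have hι (j : Over i) : c'.π.app j ≫ (opensDiagramι D i W).app j =
      e.hom ≫ k ≫ c.π.app j.left := by
    rw [reassoc_of% he]
    exact Scheme.Hom.resLE_comp_ι _ _
  obtain ⟨j, g, hg, hg'⟩ := Scheme.exists_π_app_comp_eq_of_locallyOfFinitePresentation
    (opensDiagram D i W) t' s c' hc' (e.hom ≫ h) (by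
      ext j
      have := congr($(hι j) ≫ t.app j.left)
      refine (Category.assoc _ _ _).symm.trans (this.trans ?_)
      simp only [Category.assoc]
      exact congr(e.hom ≫ $(H j.left)))
  obtain ⟨j', f, hf⟩ := exists_isAffineHom_map_comp _ c' hc' g (by
    rw [hg]
    exact ha)
  have hs : ((opensDiagram D i W).map f ≫ g) ≫ s = t'.app j' := by
    rw [Category.assoc, hg']
    exact (t'.naturality f).trans (Category.comp_id _)
  have hp : c'.π.app j' ≫ (opensDiagram D i W).map f ≫ g = e.hom ≫ h := by
    rw [← Category.assoc, c'.w]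
    exact hg
  refine ⟨j'.left, D.map j'.hom ⁻¹ᵁ W, (opensDiagram D i W).map f ≫ g, e.inv ≫ c'.π.app j',
    hf, hs, ?_, ?_⟩
  · exact (Category.assoc _ _ _).trans
      ((congr(e.inv ≫ $hp)).trans (e.inv_hom_id_assoc h))
  · refine IsOpenImmersion.isPullback _ _ _ _ ?_ ?_
    · have := congr(e.inv ≫ $(hι j'))
      rw [e.inv_hom_id_assoc] at this
      exact this.symm.trans (Category.assoc _ _ _).symm
    · rw [Scheme.Opens.opensRange_ι, ← Scheme.Hom.comp_preimage, c.w, hWk]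

/-- A quasi-compact open subscheme of an affine `S`-scheme is pulled back from an open subscheme
of an affine space over `S`. -/
theorem exists_isPullback_of_isAffine.{u} {K V S : Scheme.{u}} [IsAffine V] [IsAffine S]
    [CompactSpace K] (k : K ⟶ V) [IsOpenImmersion k] (v : V ⟶ S) :
    ∃ (T : Scheme.{u}) (s : T ⟶ S) (g : V ⟶ T) (D : T.Opens) (h : K ⟶ D.toScheme),
      IsAffine T ∧ LocallyOfFiniteType s ∧ g ≫ s = v ∧ IsCompact (D : Set T) ∧
      IsPullback k h g D.ι := by
  obtain ⟨F, hF, hFk⟩ := isCompact_and_isOpen_iff_finite_and_eq_biUnion_basicOpen.mp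
    ⟨isCompact_range k.continuous, k.opensRange.2⟩
  have : Finite F := hF
  let T := 𝔸(F; S)
  let g : V ⟶ T := AffineSpace.homOfVector v fun f ↦ f.1
  let D : T.Opens := ⨆ f : F, T.basicOpen (AffineSpace.coord S f)
  have hb (f : F) : g ⁻¹ᵁ T.basicOpen (AffineSpace.coord S f) = V.basicOpen f.1 := by
    rw [Scheme.preimage_basicOpen_top]
    exact congr(V.basicOpen $(AffineSpace.homOfVector_appTop_coord v _ f))
  have hg : g ⁻¹ᵁ D = k.opensRange := by
    rw [Scheme.Hom.preimage_iSup]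
    ext x
    have hx : x ∈ Set.range k ↔ x ∈ ⋃ i ∈ F, (V.basicOpen i : Set V) := by rw [hFk]
    refine Iff.trans ?_ hx.symm
    simp [hb]
  refine ⟨T, 𝔸(F; S) ↘ S, g, D, IsOpenImmersion.lift D.ι (k ≫ g) ?_, inferInstance, inferInstance,
    AffineSpace.homOfVector_over _ _, ?_, ?_⟩
  · refine Set.range_subset_iff.mpr fun x ↦ ?_
    rw [Scheme.Opens.range_ι]
    exact hg.ge ⟨x, rfl⟩
  · simp only [D, TopologicalSpace.Opens.coe_iSup]
    exact isCompact_iUnion fun f ↦ ((isAffineOpen_top T).basicOpen _).isCompact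
  · exact (IsOpenImmersion.isPullback _ _ _ _ (by simp) (by simpa using hg)).flip

instance isZariskiLocalAtSource_locallyOfFiniteType :
    IsZariskiLocalAtSource @LocallyOfFiniteType :=
  @HasRingHomProperty.instIsZariskiLocalAtSource @LocallyOfFiniteType _
    instHasRingHomPropertyLocallyOfFiniteTypeFiniteType

theorem exists_isAffineHom_of_isLimit_of_cover.{u} {I : Type u} [SmallCategory I] [IsCofiltered I]
    (D : I ⥤ Scheme.{u}) [∀ {i j} (f : i ⟶ j), IsAffineHom (D.map f)] (c : Cone D)
    (hc : IsLimit c) {X V K S : Scheme.{u}} [IsNoetherian S] [IsAffine S]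
    (t : D ⟶ (Functor.const I).obj S)
    (ht : ∀ i, LocallyOfFiniteType (Y := S) (t.app i) ∧ QuasiCompact (Y := S) (t.app i))
    {kU : K ⟶ c.pt} {kV : K ⟶ V} {cU : c.pt ⟶ X} {cV : V ⟶ X} [IsOpenImmersion cU]
    [IsOpenImmersion cV] [IsAffine V] [CompactSpace K] (sq : IsPullback kU kV cU cV)
    (hcov : ∀ x, x ∈ Set.range cU ∨ x ∈ Set.range cV) (x : X ⟶ S)
    (hx : ∀ i, c.π.app i ≫ t.app i = cU ≫ x) :
    ∃ (X₀ : Scheme.{u}) (a : X ⟶ X₀) (s : X₀ ⟶ S), IsAffineHom a ∧ LocallyOfFiniteType s ∧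
      QuasiCompact s ∧ a ≫ s = x := by
  have : IsOpenImmersion kU := MorphismProperty.of_isPullback sq.flip inferInstance
  have : IsOpenImmersion kV := MorphismProperty.of_isPullback sq inferInstance
  obtain ⟨T, sT, g, E, h, _, _, hg, hE, sqK⟩ := exists_isPullback_of_isAffine kV (cV ≫ x)
  have : CompactSpace E.toScheme := isCompact_iff_compactSpace.mp hE
  have : QuasiSeparatedSpace E.toScheme := quasiSeparatedSpace_of_quasiSeparated E.ι
  have hh : IsAffineHom h :=
    MorphismProperty.of_isPullback (P := @IsAffineHom) sqK (inferInstanceAs (IsAffineHom g))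
  have (i : I) : CompactSpace (D.obj i) := by
    have := (ht i).2
    exact QuasiCompact.compactSpace_of_compactSpace (Y := S) (t.app i)
  have (i : I) : QuasiSeparatedSpace (D.obj i) := by
    have := (ht i).1
    have := LocallyOfFiniteType.isLocallyNoetherian (Y := S) (t.app i)
    infer_instance
  obtain ⟨i, W, p, q, _, hp, hq, sqW⟩ := exists_isPullback_of_isLimit _ c hc t kU h (E.ι ≫ sT)
    (fun i ↦ by rw [hx, sq.w_assoc, ← hg, sqK.w_assoc])
  let ti : D.obj i ⟶ S := t.app i
  have : LocallyOfFiniteType ti := (ht i).1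
  have : QuasiCompact ti := (ht i).2
  replace hp : p ≫ E.ι ≫ sT = W.ι ≫ ti := hp
  replace hx : c.π.app i ≫ ti = cU ≫ x := hx i
  have : LocallyOfFiniteType (p ≫ E.ι ≫ sT) := by rw [hp]; infer_instance
  have : LocallyOfFiniteType p := locallyOfFiniteType_of_comp p (E.ι ≫ sT)
  obtain ⟨V₀, P, j, r, v, a, b, y, _, _, sqj, hv, _, _, hP, hP', -, sqU, sqV⟩ :=
    exists_glue_of_factors_over_open sq hcov E hE g p W.ι (c.π.app i) q sqW.w.symm
      (by rwa [hq]) (by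
        rintro z ⟨y, hy⟩
        obtain ⟨w, -, rfl⟩ := exists_eq_eq_of_isPullback sqW _ _ hy
        exact ⟨w, rfl⟩)
  have : IsAffineHom (c.π.app i) := isAffineHom_π_app _ c hc i
  have hy : IsAffineHom y := of_isPullback_of_jointly_surjective @IsAffineHom y cU cV a b _ _
    sqU sqV hP' this inferInstance
  have hw : W.ι ≫ ti = j ≫ r ≫ sT := by rw [← hp, sqj.w_assoc]
  let s : P ⟶ S := hP.desc (ti) (r ≫ sT) hw
  have hs₁ : a ≫ s = ti := hP.inl_desc _ _ _
  have hs₂ : b ≫ s = r ≫ sT := hP.inr_desc _ _ _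
  refine ⟨P, y, s, hy, ?_, ?_, ?_⟩
  · have : LocallyOfFiniteType (a ≫ s) := by rwa [hs₁]
    have : LocallyOfFiniteType (b ≫ s) := by rw [hs₂]; infer_instance
    refine IsZariskiLocalAtSource.of_iSup_eq_top (P := @LocallyOfFiniteType)
      (fun i : Bool ↦ cond i a.opensRange b.opensRange) ?_ ?_
    · rw [iSup_bool_eq, ← top_le_iff]
      exact fun y _ ↦ hP' y
    · rintro (_ | _)
      · change LocallyOfFiniteType (b.opensRange.ι ≫ s)
        rw [← b.isoOpensRange_inv_comp, Category.assoc]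
        infer_instance
      · change LocallyOfFiniteType (a.opensRange.ι ≫ s)
        rw [← a.isoOpensRange_inv_comp, Category.assoc]
        infer_instance
  · have : CompactSpace P := by
      rw [← isCompact_univ_iff, show Set.univ = Set.range a ∪ Set.range b from
        (Set.eq_univ_of_forall hP').symm]
      exact (isCompact_range a.continuous).union (isCompact_range b.continuous)
    infer_instance
  · refine (isPushout_of_isPullback_of_isOpenImmersion sq hcov).hom_ext ?_ ?_
    · rw [sqU.w_assoc, hs₁, hx]
    · rw [sqV.w_assoc, hs₂, reassoc_of% hv, hg]

theorem exists_isAffineHom_of_cover.{u} {X U V K S : Scheme.{u}} [IsNoetherian S] [IsAffine S]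
    {kU : K ⟶ U} {kV : K ⟶ V} {cU : U ⟶ X} {cV : V ⟶ X} [IsOpenImmersion cU] [IsOpenImmersion cV]
    [IsAffine V] [CompactSpace K] (sq : IsPullback kU kV cU cV)
    (hcov : ∀ x, x ∈ Set.range cU ∨ x ∈ Set.range cV) (x : X ⟶ S)
    (H : ∃ (U₀ : Scheme.{u}) (a : U ⟶ U₀) (s : U₀ ⟶ S), IsAffineHom a ∧ LocallyOfFiniteType s ∧
      QuasiCompact s ∧ a ≫ s = cU ≫ x) :
    ∃ (X₀ : Scheme.{u}) (a : X ⟶ X₀) (s : X₀ ⟶ S), IsAffineHom a ∧ LocallyOfFiniteType s ∧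
      QuasiCompact s ∧ a ≫ s = x := by
  obtain ⟨U₀, a, s, _, _, _, ha⟩ := H
  obtain ⟨I, _, _, D, π, hD, hDa, ⟨hc⟩⟩ := exists_isLimit_over a s
  have : IsConnected I := IsCofiltered.isConnected I
  have {i j : I} (f : i ⟶ j) : IsAffineHom ((D ⋙ Over.forget S).map f) := hDa i j f
  let c := (Over.forget S).mapCone (⟨Over.mk (a ≫ s), π⟩ : Cone D)
  let kU' : K ⟶ c.pt := kU
  let cU' : c.pt ⟶ X := cU
  have : IsOpenImmersion cU' := ‹IsOpenImmersion cU›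
  exact exists_isAffineHom_of_isLimit_of_cover _ c (isLimitOfPreserves (Over.forget S) hc)
    (.mk fun i ↦ (D.obj i).hom) hD (kU := kU') (cU := cU') sq hcov x
    fun i ↦ (Over.w (π.app i)).trans ha

/-- A quasi-compact quasi-separated scheme over an affine Noetherian scheme `S` is affine over a
scheme of finite type over `S`. -/
theorem exists_isAffineHom_of_compactSpace.{u} {X S : Scheme.{u}} [IsNoetherian S] [IsAffine S]
    [CompactSpace X] [QuasiSeparatedSpace X] (x : X ⟶ S) :
    ∃ (X₀ : Scheme.{u}) (a : X ⟶ X₀) (s : X₀ ⟶ S), IsAffineHom a ∧ LocallyOfFiniteType s ∧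
      QuasiCompact s ∧ a ≫ s = x := by
  let P (U : X.Opens) : Prop := ∃ (X₀ : Scheme.{u}) (a : U.toScheme ⟶ X₀) (s : X₀ ⟶ S),
    IsAffineHom a ∧ LocallyOfFiniteType s ∧ QuasiCompact s ∧ a ≫ s = U.ι ≫ x
  have key : P ⊤ := by
    refine compact_open_induction_on ⊤ isCompact_univ ?_ fun U hU V ⟨X₀, a, s, h₁, h₂, h₃, h₄⟩ ↦ ?_
    · have : IsAffine (⊥ : X.Opens).toScheme := isAffineOpen_bot X
      have : IsEmpty (⊥ : X.Opens).toScheme := inferInstanceAs (IsEmpty (∅ : Set X))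
      exact ⟨_, 𝟙 _, (⊥ : X.Opens).ι ≫ x, inferInstance, inferInstance, inferInstance,
        Category.id_comp _⟩
    · have hV : IsAffine V.1.toScheme := V.2
      have : CompactSpace (U ⊓ V.1 : X.Opens).toScheme :=
        isCompact_iff_compactSpace.mp (hU.inter_of_isOpen V.2.isCompact U.2 V.1.2)
      refine exists_isAffineHom_of_cover (cU := X.homOfLE le_sup_left)
        (cV := X.homOfLE (le_sup_right (a := U) (b := V.1))) (kU := X.homOfLE inf_le_left)
        (kV := X.homOfLE (inf_le_right (a := U) (b := V.1))) ?_ ?_ _ ⟨X₀, a, s, h₁, h₂, h₃, ?_⟩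
      · exact isPullback_opens_inf_le le_sup_left le_sup_right
      · rintro ⟨s, hs⟩
        exact hs.imp (fun h ↦ ⟨⟨s, h⟩, Subtype.ext (by simp)⟩)
          (fun h ↦ ⟨⟨s, h⟩, Subtype.ext (by simp)⟩)
      · simpa using h₄
  obtain ⟨X₀, a, s, _, _, _, h⟩ := key
  exact ⟨X₀, X.topIso.inv ≫ a, s, inferInstance, ‹_›, ‹_›, by simp [h]⟩

/-- The `S`-schemes locally of finite type under a fixed `S`-scheme `Y`. -/
abbrev UnderFiniteType.{u} {S : Scheme.{u}} (Y : Over S) :=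
  ObjectProperty.FullSubcategory fun Z : Under Y ↦ LocallyOfFiniteType Z.right.hom

/-- A cone over a diagram of `S`-schemes locally of finite type, with apex under `Y`, as a functor
to the `S`-schemes locally of finite type under `Y`. -/
def toUnderFiniteType.{u} {S : Scheme.{u}} {I : Type u} [SmallCategory I] {X Y : Over S} (f : Y ⟶ X)
    (D : I ⥤ Over S) (π : (Functor.const I).obj X ⟶ D)
    (hD : ∀ i, LocallyOfFiniteType (D.obj i).hom) : I ⥤ UnderFiniteType Y where
  obj i := ⟨Under.mk (f ≫ π.app i), hD i⟩
  map {i j} φ := ObjectProperty.homMk (Under.homMk (D.map φ) (by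
    have := π.naturality φ
    simp at this
    simp [this]))
  map_id i := by ext : 2; simp
  map_comp φ ψ := by ext : 2; simp

theorem initial_toUnderFiniteType.{u} {S : Scheme.{u}} [IsNoetherian S] {I : Type u}
    [SmallCategory I] [IsCofiltered I] {Y : Over S} (D : I ⥤ Over S)
    (π : (Functor.const I).obj Y ⟶ D)
    (hD : ∀ i, LocallyOfFiniteType (D.obj i).hom ∧ QuasiCompact (D.obj i).hom)
    (hDa : ∀ i j (φ : i ⟶ j), IsAffineHom (D.map φ).left)
    (hc : IsLimit (⟨Y, π⟩ : Cone D)) :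
    (toUnderFiniteType (𝟙 Y) D π (fun i ↦ (hD i).1)).Initial := by
  have : IsConnected I := IsCofiltered.isConnected I
  have {i j : I} (f : i ⟶ j) : IsAffineHom ((D ⋙ Over.forget S).map f) := hDa i j f
  have (i : I) : CompactSpace ((D ⋙ Over.forget S).obj i) := by
    have := (hD i).2
    exact QuasiCompact.compactSpace_of_compactSpace (X := (D.obj i).left) (Y := S) (D.obj i).hom
  have (i : I) : QuasiSeparatedSpace ((D ⋙ Over.forget S).obj i) := by
    have := (hD i).1
    have := LocallyOfFiniteType.isLocallyNoetherian (Y := S) (D.obj i).hom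
    exact inferInstanceAs (QuasiSeparatedSpace (D.obj i).left)
  refine Functor.initial_of_exists_of_isCofiltered _ ?_ ?_
  · rintro ⟨Z, hZ⟩
    obtain ⟨k, u, h, h'⟩ := Scheme.exists_π_app_comp_eq_of_locallyOfFinitePresentation
      (D ⋙ Over.forget _) (.mk (fun _ ↦ (D.obj _).hom)) Z.right.hom _
      (isLimitOfPreserves (Over.forget S) hc) Z.hom.left (by
        ext i
        exact (Over.w (π.app i)).trans (Over.w Z.hom).symm)
    refine ⟨k, ⟨ObjectProperty.homMk (Under.homMk (Over.homMk u h') ?_)⟩⟩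
    ext
    exact congr($(Category.id_comp (π.app k)).left ≫ u).trans h
  · rintro ⟨Z, hZ⟩ i a b
    obtain ⟨k, hik, heq⟩ := Scheme.exists_hom_comp_eq_comp_of_locallyOfFiniteType
        (D ⋙ Over.forget _) (.mk (fun _ ↦ (D.obj _).hom)) Z.right.hom _
        (isLimitOfPreserves (Over.forget S) hc)
        a.hom.right.left b.hom.right.left (Over.w a.hom.right).symm (Over.w b.hom.right).symm
        (by
          have h : (𝟙 Y ≫ π.app i) ≫ a.hom.right = (𝟙 Y ≫ π.app i) ≫ b.hom.right :=
            (Under.w a.hom).trans (Under.w b.hom).symm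
          rw [Category.id_comp] at h
          exact congr(($h).left))
    refine ⟨k, hik, ?_⟩
    ext : 3
    exact heq

/-- Every morphism `f : Y ⟶ X` of quasi-compact quasi-separated schemes over `Spec ℚ` is a
cofiltered limit of morphisms of finite type `ℚ`-schemes along affine transition maps: there
are cofiltered diagrams `Xd` and `Yd` of finite type `ℚ`-schemes with affine transitions, a
natural transformation `fd : Yd ⟶ Xd`, and limit cones `π` and `ρ` over `Xd` and `Yd` with
apexes `X` and `Y` respectively, compatible with `f`. -/
theorem morphism_qcqs_is_cofiltered_limit_of_finite_type
    (X Y : Scheme) (sX : X ⟶ Spec (CommRingCat.of ℚ)) (sY : Y ⟶ Spec (CommRingCat.of ℚ))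
    [CompactSpace X] [QuasiSeparatedSpace X]
    [CompactSpace Y] [QuasiSeparatedSpace Y]
    (f : Y ⟶ X) (hf : f ≫ sX = sY) :
    ∃ (I : Type) (_ : SmallCategory I) (_ : IsCofiltered I)
      (Xd Yd : I ⥤ Over (Spec (CommRingCat.of ℚ)))
      (fd : Yd ⟶ Xd)
      (π : (Functor.const I).obj (Over.mk sX) ⟶ Xd)
      (ρ : (Functor.const I).obj (Over.mk sY) ⟶ Yd),
      (∀ i, LocallyOfFiniteType (Xd.obj i).hom ∧ QuasiCompact (Xd.obj i).hom) ∧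
      (∀ i, LocallyOfFiniteType (Yd.obj i).hom ∧ QuasiCompact (Yd.obj i).hom) ∧
      (∀ (i j : I) (φ : i ⟶ j), IsAffineHom (Xd.map φ).left ∧ IsAffineHom (Yd.map φ).left) ∧
      Nonempty (IsLimit (⟨Over.mk sX, π⟩ : Cone Xd)) ∧
      Nonempty (IsLimit (⟨Over.mk sY, ρ⟩ : Cone Yd)) ∧
      (∀ i, f ≫ (π.app i).left = (ρ.app i).left ≫ (fd.app i).left) := by
  obtain ⟨X₀, a, s, _, _, _, rfl⟩ := exists_isAffineHom_of_compactSpace sX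
  obtain ⟨Y₀, b, t, _, _, _, rfl⟩ := exists_isAffineHom_of_compactSpace sY
  obtain ⟨I, _, _, D, π, hD, hDa, ⟨hc⟩⟩ := exists_isLimit_over a s
  obtain ⟨J, _, _, E, ρ, hE, hEa, ⟨hd⟩⟩ := exists_isLimit_over b t
  let g : Over.mk (b ≫ t) ⟶ Over.mk (a ≫ s) := Over.homMk f hf
  let L := toUnderFiniteType (𝟙 _) E ρ (fun j ↦ (hE j).1)
  let R := toUnderFiniteType g D π (fun i ↦ (hD i).1)
  have : L.Initial := initial_toUnderFiniteType E ρ hE hEa hd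
  have := Comma.isCofiltered_of_initial L R
  have h₁ := (Functor.Initial.isLimitWhiskerEquiv (Comma.snd L R) (⟨_, π⟩ : Cone D)).symm hc
  have h₂ := (Functor.Initial.isLimitWhiskerEquiv (Comma.fst L R) (⟨_, ρ⟩ : Cone E)).symm hd
  refine ⟨Comma L R, inferInstance, this, Comma.snd L R ⋙ D, Comma.fst L R ⋙ E,
    { app i := i.hom.hom.right
      naturality i j φ := congr(($φ.w).hom.right) }, _, _, fun i ↦ hD _, fun i ↦ hE _,
      fun i j φ ↦ ⟨hDa _ _ _, hEa _ _ _⟩, ⟨h₁⟩, ⟨h₂⟩, fun i ↦ ?_⟩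
  have h : (𝟙 _ ≫ ρ.app i.left) ≫ i.hom.hom.right = g ≫ π.app i.right := Under.w i.hom.hom
  rw [Category.id_comp] at h
  exact congr(($h).left).symm
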